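/- arXiv:math/0304118 — 2 statements merged into one kernel-verified Lean document; each statement's English description precedes it below -/
import Mathlib

section
/- Let (O, m) be a two-dimensional regular local ring containing a field k that maps isomorphically onto the residue field O/m, and let J ⊆ O be an ideal of height two (so O/J has finite length, hence finite k-dimension). Then dim_k(J/J²) ≥ 2·dim_k(O/J). Moreover, equality holds if and only if J is a complete intersection in O, i.e., J is generated by an O-regular sequence of length two. -/
/-!
STATEMENT 12: (O, m) a two-dimensional regular local ring containing a field k
mapping isomorphically onto the residue field O/m; J ⊆ O an ideal of height
two.  Then dim_k(J/J²) ≥ 2·dim_k(O/J), with equality iff J is a complete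
intersection (generated by an O-regular sequence of length two).
-/

noncomputable section

/-- Height of an ideal: infimum of the heights of the primes containing it. -/
def idealHeight {A : Type*} [CommRing A] (I : Ideal A) : ℕ∞ :=
  ⨅ (P : PrimeSpectrum A) (_ : I ≤ P.asIdeal), Order.height P

open TensorProduct

theorem aux_star {O : Type*} [CommRing O] [IsLocalRing O] [IsNoetherianRing O]
    (P0 P1 : Ideal O) [P0.IsPrime] [P1.IsPrime] (h01 : P0 < P1)
    (h1m : P1 < IsLocalRing.maximalIdeal O) (z : O) (hz : z ∈ IsLocalRing.maximalIdeal O) :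
    ¬ IsLocalRing.maximalIdeal O ≤ (P0 ⊔ Ideal.span {z}).radical := by
  intro h
  have key : P1 ∈ (Ideal.span (P0 : Set O)).minimalPrimes := by
    refine Ideal.mem_minimalPrimes_span_of_mem_minimalPrimes_span_insert h1m z (P0 : Set O) ?_
      (P0 : Set O) h01.le ?_
    · refine ⟨⟨inferInstance, ?_⟩, ?_⟩
      · rw [Ideal.span_le, Set.insert_subset_iff]
        exact ⟨hz, (h01.trans h1m).le⟩
      · rintro q ⟨hq, hq2⟩ -
        refine h.trans ((Ideal.IsPrime.isRadical hq).radical_le_iff.mpr ?_)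
        rw [Ideal.span_insert, Ideal.span_eq] at hq2
        exact sup_comm (Ideal.span {z}) P0 ▸ hq2
    · exact fun a ha => Ideal.le_radical (Ideal.subset_span (Set.mem_insert_of_mem _ ha))
  rw [Ideal.span_eq] at key
  exact absurd (key.2 ⟨inferInstance, le_rfl⟩ h01.le) (not_le_of_gt h01)

/-- Elements outside `(x)` look like unit times a power of `y` modulo `x`. -/
theorem aux_rep {O : Type*} [CommRing O] [IsLocalRing O] [IsNoetherianRing O]
    (x y : O) (hm : IsLocalRing.maximalIdeal O = Ideal.span {x, y}) (h : O)
    (hh : h ∉ Ideal.span {x}) :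
    ∃ (n : ℕ) (e : O), IsUnit e ∧ h - e * y ^ n ∈ Ideal.span {x} := by
  classical
  have hx : x ∈ IsLocalRing.maximalIdeal O := hm ▸ Ideal.subset_span (by simp)
  have hex : ∃ n, h ∉ Ideal.span {x} ⊔ Ideal.span {y ^ n} := by
    by_contra! hc
    have hnt : Nontrivial (O ⧸ Ideal.span {x}) := by
      refine Ideal.Quotient.nontrivial_iff.mpr fun h => ?_
      exact Ideal.IsPrime.ne_top (inferInstance : (IsLocalRing.maximalIdeal O).IsPrime)
        (top_le_iff.mp (h ▸ (Ideal.span_singleton_le_iff_mem _).mpr hx))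
    have : IsLocalRing (O ⧸ Ideal.span {x}) :=
      IsLocalRing.of_surjective' (Ideal.Quotient.mk _) Ideal.Quotient.mk_surjective
    have hy : (Ideal.span {Ideal.Quotient.mk (Ideal.span {x}) y}) ≠ ⊤ := by
      intro ht
      rw [Ideal.span_singleton_eq_top] at ht
      have hloc : IsLocalHom (Ideal.Quotient.mk (Ideal.span {x})) :=
        IsLocalHom.of_surjective _ Ideal.Quotient.mk_surjective
      have := isUnit_of_map_unit _ _ ht
      exact (IsLocalRing.mem_maximalIdeal y).mp (hm ▸ Ideal.subset_span (by simp)) this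
    have h0 := Ideal.iInf_pow_eq_bot_of_isLocalRing _ hy
    apply hh
    rw [← Ideal.Quotient.eq_zero_iff_mem, ← Ideal.mem_bot, ← h0, Ideal.mem_iInf]
    intro i
    obtain ⟨a, ha, b, hb, hab⟩ := Submodule.mem_sup.mp (hc i)
    rw [← hab, map_add, Ideal.Quotient.eq_zero_iff_mem.mpr ha, zero_add,
      Ideal.span_singleton_pow]
    obtain ⟨c, rfl⟩ := Ideal.mem_span_singleton'.mp hb
    rw [map_mul, map_pow]
    exact Ideal.mul_mem_left _ _ (Ideal.mem_span_singleton_self _)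
  have hn := Nat.find_spec hex
  have hmin := fun k => Nat.find_min hex (m := k)
  cases hN : Nat.find hex with
  | zero => simp [hN] at hn
  | succ n =>
    have h1 := hmin n (by omega)
    rw [hN] at hn
    rw [not_not] at h1
    obtain ⟨a, ha, b, hb, hab⟩ := Submodule.mem_sup.mp h1
    obtain ⟨c, rfl⟩ := Ideal.mem_span_singleton'.mp hb
    refine ⟨n, c, ?_, ?_⟩
    · by_contra hc
      have hc' : c ∈ IsLocalRing.maximalIdeal O := (IsLocalRing.mem_maximalIdeal _).mpr hc
      rw [hm, Ideal.mem_span_pair] at hc'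
      obtain ⟨p, q, rfl⟩ := hc'
      apply hn
      rw [← hab]
      have : a + (p * x + q * y) * y ^ n = (a + (p * y ^ n) * x) + q * y ^ (n+1) := by ring
      rw [this]
      exact Submodule.add_mem_sup (Ideal.add_mem _ ha
        (Ideal.mul_mem_left _ _ (Ideal.mem_span_singleton_self _)))
        (Ideal.mul_mem_left _ _ (Ideal.mem_span_singleton_self _))
    · rw [← hab]; simpa using ha

theorem aux_chain {O : Type*} [CommRing O] [IsLocalRing O] [IsNoetherianRing O]
    (hdim : ringKrullDim O = 2) : ∃ P0 P1 : Ideal O, P0.IsPrime ∧ P1.IsPrime ∧ P0 < P1 ∧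
      P1 < IsLocalRing.maximalIdeal O := by
  have hh : (IsLocalRing.maximalIdeal O).height = 2 := by
    have := IsLocalRing.maximalIdeal_height_eq_ringKrullDim (R := O)
    rw [hdim] at this
    exact WithBot.coe_injective (this.trans rfl)
  obtain ⟨l, hl, hl2⟩ := Ideal.exists_ltSeries_length_eq_height (IsLocalRing.maximalIdeal O)
  rw [hh] at hl2
  have hl3 : l.length = 2 := by exact_mod_cast hl2
  refine ⟨(l ⟨0, by omega⟩).asIdeal, (l ⟨1, by omega⟩).asIdeal, inferInstance, inferInstance, ?_, ?_⟩
  · exact l.strictMono (by simp [Fin.lt_def])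
  · have h1 : l ⟨1, by omega⟩ < l.last := l.strictMono (by simp [Fin.lt_def, Fin.last, hl3])
    rw [show l.last = _ from hl] at h1
    exact h1

/-- In a regular local ring of dimension two: domain, Koszul exactness. -/
theorem aux_regular {O : Type*} [CommRing O] [IsLocalRing O] [IsNoetherianRing O]
    (hdim : ringKrullDim O = 2)
    (x y : O) (hm : IsLocalRing.maximalIdeal O = Ideal.span {x, y}) :
    IsDomain O ∧ x ≠ 0 ∧ ∀ g h : O, x * g + y * h = 0 → ∃ c, g = y * c ∧ h = - (x * c) := by
  obtain ⟨P0, P1, hP0, hP1, h01, h1m⟩ := aux_chain hdim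
  have hx : x ∈ IsLocalRing.maximalIdeal O := hm ▸ Ideal.subset_span (by simp)
  have hy : y ∈ IsLocalRing.maximalIdeal O := hm ▸ Ideal.subset_span (by simp)
  have hyn : ∀ n, y ^ n ∉ P0 ⊔ Ideal.span {x} := by
    intro n hn
    refine aux_star P0 P1 h01 h1m x hx ?_
    rw [hm, Ideal.span_le]
    rintro a (rfl | rfl)
    · exact Ideal.le_radical ((le_sup_right : _ ≤ P0 ⊔ Ideal.span {a})
        (Ideal.mem_span_singleton_self a))
    · exact ⟨n, hn⟩
  have hx0 : x ∉ P0 := by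
    intro h0
    refine aux_star P0 P1 h01 h1m y hy ?_
    rw [hm, Ideal.span_le]
    rintro a (rfl | rfl)
    · exact Ideal.le_radical ((le_sup_left : P0 ≤ _) h0)
    · exact Ideal.le_radical ((le_sup_right : _ ≤ P0 ⊔ Ideal.span {a})
        (Ideal.mem_span_singleton_self a))
  have hle : P0 ≤ Ideal.span {x} := by
    intro p hp
    by_contra hpx
    obtain ⟨n, e, he, hpe⟩ := aux_rep x y hm p hpx
    apply hyn n
    rw [← Ideal.unit_mul_mem_iff_mem _ he]
    have : e * y ^ n = p - (p - e * y ^ n) := by ring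
    rw [this]
    exact Ideal.sub_mem _ ((le_sup_left : P0 ≤ _) hp)
      ((le_sup_right : _ ≤ P0 ⊔ Ideal.span {x}) hpe)
  have hbot : P0 = ⊥ := by
    refine Submodule.eq_bot_of_le_smul_of_le_jacobson_bot (IsLocalRing.maximalIdeal O) P0
      (IsNoetherian.noetherian _) ?_ ?_
    · intro p hp
      obtain ⟨r, rfl⟩ := Ideal.mem_span_singleton'.mp (hle hp)
      rw [mul_comm]
      exact Submodule.smul_mem_smul hx ((hP0.mem_or_mem hp).resolve_right hx0)
    · rw [IsLocalRing.jacobson_eq_maximalIdeal _ bot_ne_top]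
  subst hbot
  have hdom : IsDomain O := IsDomain.of_bot_isPrime O
  have hxne : x ≠ 0 := fun h => hx0 (by simp [h])
  refine ⟨hdom, hxne, fun g h hgh => ?_⟩
  have hhx : h ∈ Ideal.span {x} := by
    by_contra hpx
    obtain ⟨n, e, he, hpe⟩ := aux_rep x y hm h hpx
    apply hyn (n+1)
    rw [← Ideal.unit_mul_mem_iff_mem _ he]
    have : e * y ^ (n+1) = - g * x - y * (h - e * y ^ n) := by linear_combination hgh
    rw [this, bot_sup_eq]
    exact Ideal.sub_mem _ (Ideal.mul_mem_left _ _ (Ideal.mem_span_singleton_self _))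
      (Ideal.mul_mem_left _ _ hpe)
  obtain ⟨r, rfl⟩ := Ideal.mem_span_singleton'.mp hhx
  refine ⟨-r, ?_, by ring⟩
  apply mul_left_cancel₀ hxne
  linear_combination hgh

/-- regularity of two generators of an m-primary ideal -/
theorem aux_isRegular {O : Type*} [CommRing O] [IsLocalRing O] [IsNoetherianRing O]
    (hdim : ringKrullDim O = 2)
    (x y : O) (hm : IsLocalRing.maximalIdeal O = Ideal.span {x, y})
    (a b : O) (N : ℕ) (hN : IsLocalRing.maximalIdeal O ^ N ≤ Ideal.span {a, b})
    (hab : Ideal.span {a, b} ≤ IsLocalRing.maximalIdeal O) :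
    ∃ x y : O, Ideal.span {a, b} = Ideal.span {x, y} ∧ RingTheory.Sequence.IsRegular O [x, y] := by
  obtain ⟨hdom, hx0, hk⟩ := aux_regular hdim x y hm
  obtain ⟨P0, P1, hP0, hP1, h01, h1m⟩ := aux_chain hdim
  have main : ∀ a b : O, a ≠ 0 → IsLocalRing.maximalIdeal O ^ N ≤ Ideal.span {a, b} →
    Ideal.span {a, b} ≤ IsLocalRing.maximalIdeal O → RingTheory.Sequence.IsRegular O [a, b] := by
    intro a b ha hN hab
    have hmt : ∀ t, x * t ∈ Ideal.span {a} → y * t ∈ Ideal.span {a} → t ∈ Ideal.span {a} := by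
      intro t h1 h2
      obtain ⟨r, hr⟩ := Ideal.mem_span_singleton'.mp h1
      obtain ⟨s, hs⟩ := Ideal.mem_span_singleton'.mp h2
      have : x * s + y * (-r) = 0 := by
        apply mul_left_cancel₀ ha
        linear_combination x * hs - y * hr
      obtain ⟨c, hc1, hc2⟩ := hk _ _ this
      refine Ideal.mem_span_singleton'.mpr ⟨c, ?_⟩
      apply mul_left_cancel₀ hx0
      have : r = x * c := by linear_combination - hc2
      rw [← hr, this]; ring
    have hmn : ∀ n t, (∀ r ∈ IsLocalRing.maximalIdeal O ^ n, r * t ∈ Ideal.span {a}) →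
        t ∈ Ideal.span {a} := by
      intro n
      induction n with
      | zero => intro t h; simpa using h 1 (by simp)
      | succ n ih =>
        intro t h
        have hxm : x ∈ IsLocalRing.maximalIdeal O := hm ▸ Ideal.subset_span (by simp)
        have hym : y ∈ IsLocalRing.maximalIdeal O := hm ▸ Ideal.subset_span (by simp)
        apply hmt
        · apply ih; intro r hr
          rw [← mul_assoc]; exact h _ (by rw [pow_succ]; exact Ideal.mul_mem_mul hr hxm)
        · apply ih; intro r hr
          rw [← mul_assoc]; exact h _ (by rw [pow_succ]; exact Ideal.mul_mem_mul hr hym)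
    refine (IsLocalRing.isRegular_iff_isWeaklyRegular_of_subset_maximalIdeal ?_).mpr ?_
    · intro r hr
      apply hab
      apply Ideal.subset_span
      simpa using hr
    · rw [RingTheory.Sequence.isWeaklyRegular_cons_iff,
        RingTheory.Sequence.isWeaklyRegular_singleton_iff]
      refine ⟨fun u v huv => mul_left_cancel₀ ha huv, ?_⟩
      rw [isSMulRegular_quotient_iff_mem_of_smul_mem]
      intro t ht
      rw [← Submodule.ideal_span_singleton_smul, smul_eq_mul, Ideal.mul_top] at ht ⊢
      apply hmn N
      intro r hr
      obtain ⟨p, q, rfl⟩ := Ideal.mem_span_pair.mp (hN hr)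
      rw [show (p * a + q * b) * t = (p * t) * a + q * (b * t) by ring]
      exact Ideal.add_mem _ (Ideal.mul_mem_left _ _ (Ideal.mem_span_singleton_self _))
        (Ideal.mul_mem_left _ _ ht)
  by_cases ha : a = 0
  · have hsw : Ideal.span {a, b} = Ideal.span {b, a} := by rw [Set.pair_comm]
    refine ⟨b, a, hsw, main b a ?_ (hsw ▸ hN) (hsw ▸ hab)⟩
    rintro rfl
    subst ha
    have hb : Ideal.span {(0:O), 0} = ⊥ := by simp
    rw [hb] at hN
    have : IsLocalRing.maximalIdeal O ≤ P0 := by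
      intro r hr
      exact hP0.mem_of_pow_mem N ((hN.trans bot_le) (Ideal.pow_mem_pow hr N))
    exact absurd (h01.trans h1m) (not_lt_of_ge this)
  · exact ⟨a, b, rfl, main a b ha hN hab⟩


theorem aux_lin {k W : Type*} [Field k] [AddCommGroup W] [Module k W] [FiniteDimensional k W]
    (τ P Q P' Q' : W →ₗ[k] W) (_hτ : ∀ w, τ (τ w) = w)
    (hP : ∀ w, τ (P w) = P' (τ w)) (hQ : ∀ w, τ (Q w) = Q' (τ w))
    (hQ' : ∀ w, τ (Q' w) = Q (τ w))
    (hPQ : ∀ w, P (Q w) = Q (P w)) (hPQ' : ∀ w, P (Q' w) = Q' (P w))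
    (hP'Q : ∀ w, P' (Q w) = Q (P' w)) (ℓ : ℕ)
    (h1 : Module.finrank k W + ℓ ≤ 2 * Module.finrank k (LinearMap.ker (LinearMap.id - τ)))
    (h2 : Module.finrank k W ≤
      Module.finrank k (LinearMap.range ((P - P').coprod (Q - Q'))) + ℓ) :
    ℓ ≤ Module.finrank k ↥(LinearMap.ker (LinearMap.id - τ) ⊓ LinearMap.ker (P - P') ⊓
      LinearMap.ker (Q - Q')) := by
  set S := LinearMap.ker (LinearMap.id - τ) with hS
  have memS : ∀ w, w ∈ S ↔ τ w = w := by
    intro w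
    rw [hS, LinearMap.mem_ker, LinearMap.sub_apply, LinearMap.id_apply, sub_eq_zero, eq_comm]
  let γ : W × W × W →ₗ[k] W := (Q - Q').coprod ((-(P - P')).coprod (LinearMap.id - τ))
  let i1 : S × S × S × S →ₗ[k] W := S.subtype ∘ₗ LinearMap.fst k S (S × S × S)
  let i2 : S × S × S × S →ₗ[k] W :=
    S.subtype ∘ₗ LinearMap.fst k S (S × S) ∘ₗ LinearMap.snd k S (S × S × S)
  let i3 : S × S × S × S →ₗ[k] W :=
    S.subtype ∘ₗ LinearMap.fst k S S ∘ₗ LinearMap.snd k S (S × S) ∘ₗ LinearMap.snd k S (S × S × S)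
  let i4 : S × S × S × S →ₗ[k] W :=
    S.subtype ∘ₗ LinearMap.snd k S S ∘ₗ LinearMap.snd k S (S × S) ∘ₗ LinearMap.snd k S (S × S × S)
  let δ : S × S × S × S →ₗ[k] W × W × W :=
    (P ∘ₗ i1 + i2).prod ((Q ∘ₗ i1 + i3).prod (P ∘ₗ Q' ∘ₗ i1 - Q ∘ₗ i2 + P ∘ₗ i3 + i4))
  have hδ : ∀ z a b c : S, δ (z, a, b, c) =
    (P z + a, Q z + b, P (Q' z) - Q a + P b + c) := fun z a b c => rfl
  have hγ : ∀ a b c : W, γ (a, b, c) = (Q a - Q' a) + (-(P b - P' b) + (c - τ c)) :=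
    fun a b c => rfl
  have hle : LinearMap.range δ ≤ LinearMap.ker γ := by
    rintro _ ⟨⟨⟨z, hz⟩, ⟨a, ha⟩, ⟨b, hb⟩, ⟨c, hc⟩⟩, rfl⟩
    rw [memS] at hz ha hb hc
    rw [LinearMap.mem_ker, hδ, hγ]
    simp only [map_add, map_sub, hP, hQ, hQ', hz, ha, hb, hc, hPQ, hPQ', hP'Q]
    abel
  have hrγ : LinearMap.range ((P - P').coprod (Q - Q')) ≤ LinearMap.range γ := by
    rintro _ ⟨⟨a, b⟩, rfl⟩
    refine ⟨(b, -a, 0), ?_⟩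
    rw [hγ]
    simp only [map_neg, map_zero, LinearMap.coprod_apply, LinearMap.sub_apply]
    abel
  let T := S ⊓ LinearMap.ker (P - P') ⊓ LinearMap.ker (Q - Q')
  have hker : Module.finrank k (LinearMap.ker δ) ≤ Module.finrank k T := by
    have hmap : ∀ w : LinearMap.ker δ, (i1 ∘ₗ (LinearMap.ker δ).subtype) w ∈ T := by
      rintro ⟨⟨⟨z, hz⟩, ⟨a, ha⟩, ⟨b, hb⟩, ⟨c, hc⟩⟩, hw⟩
      rw [LinearMap.mem_ker, hδ, Prod.mk_eq_zero, Prod.mk_eq_zero] at hw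
      rw [memS] at hz ha hb hc
      change z ∈ T
      obtain ⟨e1, e2, e3⟩ := hw
      simp only at e1 e2 e3
      have f1 := congrArg τ e1
      have f2 := congrArg τ e2
      simp only [map_add, hP, hQ, hz, ha, hb, map_zero] at f1 f2
      refine ⟨⟨(memS z).mpr hz, ?_⟩, ?_⟩
      · rw [SetLike.mem_coe, LinearMap.mem_ker, LinearMap.sub_apply,
          eq_neg_of_add_eq_zero_left e1, eq_neg_of_add_eq_zero_left f1, sub_self]
      · rw [SetLike.mem_coe, LinearMap.mem_ker, LinearMap.sub_apply,
          eq_neg_of_add_eq_zero_left e2, eq_neg_of_add_eq_zero_left f2, sub_self]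
    refine LinearMap.finrank_le_finrank_of_injective
      (f := (i1 ∘ₗ (LinearMap.ker δ).subtype).codRestrict T hmap) ?_
    rw [injective_iff_map_eq_zero]
    rintro ⟨⟨⟨z, hz⟩, ⟨a, ha⟩, ⟨b, hb⟩, ⟨c, hc⟩⟩, hw⟩ h0
    have hz0 : z = 0 := congrArg Subtype.val h0
    subst hz0
    rw [LinearMap.mem_ker, hδ, Prod.mk_eq_zero, Prod.mk_eq_zero] at hw
    obtain ⟨e1, e2, e3⟩ := hw
    simp only [map_zero, zero_add] at e1 e2 e3
    subst e1
    subst e2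
    simp only [map_zero, zero_add, sub_zero] at e3
    subst e3
    rfl
  have r1 := LinearMap.finrank_range_add_finrank_ker δ
  have r2 := LinearMap.finrank_range_add_finrank_ker γ
  have r3 := Submodule.finrank_mono hle
  have r4 := Submodule.finrank_mono hrγ
  simp only [Module.finrank_prod] at r1 r2
  change ℓ ≤ Module.finrank k T
  omega

theorem aux_sym_dim {k V : Type*} [Field k] [AddCommGroup V] [Module k V]
    [FiniteDimensional k V] :
    Module.finrank k (V ⊗[k] V) + Module.finrank k V ≤ 2 * Module.finrank k
      (LinearMap.ker (LinearMap.id - (TensorProduct.comm k V V).toLinearMap)) := by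
  set D := LinearMap.id - (TensorProduct.comm k V V).toLinearMap with hD
  set n := Module.finrank k V with hn
  let b := Module.finBasis k V
  have hDt : ∀ v w : V, D (v ⊗ₜ w) = v ⊗ₜ w - w ⊗ₜ v := fun v w => rfl
  let F : (Σ j : Fin n, Fin (j : ℕ)) → V ⊗[k] V := fun p =>
    D (b (⟨p.2, p.2.2.trans p.1.2⟩ : Fin n) ⊗ₜ b p.1)
  have hlt : ∀ i j : Fin n, i < j → D (b i ⊗ₜ b j) ∈ Submodule.span k (Set.range F) := by
    intro i j hij
    exact Submodule.subset_span ⟨⟨j, ⟨i, hij⟩⟩, rfl⟩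
  have hle : LinearMap.range D ≤ Submodule.span k (Set.range F) := by
    rw [LinearMap.range_eq_map, ← (b.tensorProduct b).span_eq, Submodule.map_span,
      Submodule.span_le]
    rintro _ ⟨_, ⟨⟨i, j⟩, rfl⟩, rfl⟩
    rw [Module.Basis.tensorProduct_apply]
    rcases lt_trichotomy i j with h | h | h
    · exact hlt i j h
    · subst h; rw [hDt, sub_self]; exact Submodule.zero_mem _
    · have : D (b i ⊗ₜ b j) = - D (b j ⊗ₜ b i) := by rw [hDt, hDt]; abel
      rw [this]
      exact Submodule.neg_mem _ (hlt j i h)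
  have h1 := Submodule.finrank_mono hle
  have h2 := finrank_range_le_card (R := k) F
  have h3 : Fintype.card (Σ j : Fin n, Fin (j : ℕ)) * 2 = n * (n - 1) := by
    rw [Fintype.card_sigma]
    simp only [Fintype.card_fin]
    rw [Fin.sum_univ_eq_sum_range (fun i => i), Finset.sum_range_id_mul_two]
  have h4 := LinearMap.finrank_range_add_finrank_ker D
  have h5 : Module.finrank k (V ⊗[k] V) = n * n := Module.finrank_tensorProduct
  have h6 : n * (n - 1) + n = n * n := by
    cases n with
    | zero => simp
    | succ m => simp; ring
  unfold Set.finrank at h2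
  omega

theorem aux_two_gen {k V : Type*} [Field k] [AddCommGroup V] [Module k V]
    [FiniteDimensional k V] (K E : Submodule k V)
    (h : Module.finrank k E ≤ Module.finrank k K + 2) (hKE : K ≤ E) :
    ∃ e1 ∈ E, ∃ e2 ∈ E, ∀ e ∈ E, ∃ c1 c2 : k, ∃ z ∈ K, e = c1 • e1 + c2 • e2 + z := by
  have h1 : ∀ F : Submodule k V, F ≤ E → Module.finrank k E ≤ Module.finrank k F + 1 →
      ∃ e ∈ E, ∀ v ∈ E, ∃ c : k, ∃ z ∈ F, v = c • e + z := by
    intro F hF hd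
    by_cases hEF : E ≤ F
    · exact ⟨0, E.zero_mem, fun v hv => ⟨0, v, hEF hv, by simp⟩⟩
    · obtain ⟨e, he, heF⟩ := SetLike.not_le_iff_exists.mp hEF
      refine ⟨e, he, fun v hv => ?_⟩
      have hlt : F < F ⊔ Submodule.span k {e} := by
        refine lt_of_le_of_ne le_sup_left fun h => heF ?_
        rw [h]
        exact Submodule.mem_sup_right (Submodule.mem_span_singleton_self e)
      have hle : F ⊔ Submodule.span k {e} ≤ E :=
        sup_le hF ((Submodule.span_singleton_le_iff_mem _ _).mpr he)
      have hl := Submodule.finrank_lt_finrank_of_lt hlt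
      have heq := Submodule.eq_of_le_of_finrank_le hle (by omega)
      rw [← heq] at hv
      obtain ⟨z, hz, w, hw, rfl⟩ := Submodule.mem_sup.mp hv
      obtain ⟨c, rfl⟩ := Submodule.mem_span_singleton.mp hw
      exact ⟨c, z, hz, add_comm _ _⟩
  by_cases hEK : E ≤ K
  · exact ⟨0, E.zero_mem, 0, E.zero_mem, fun v hv => ⟨0, 0, v, hEK hv, by simp⟩⟩
  · obtain ⟨e, he, heF⟩ := SetLike.not_le_iff_exists.mp hEK
    have hlt : K < K ⊔ Submodule.span k {e} := by
      refine lt_of_le_of_ne le_sup_left fun h => heF ?_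
      rw [h]
      exact Submodule.mem_sup_right (Submodule.mem_span_singleton_self e)
    have hle : K ⊔ Submodule.span k {e} ≤ E :=
      sup_le hKE ((Submodule.span_singleton_le_iff_mem _ _).mpr he)
    have hl := Submodule.finrank_lt_finrank_of_lt hlt
    obtain ⟨e', he', h'⟩ := h1 _ hle (by omega)
    refine ⟨e, he, e', he', fun v hv => ?_⟩
    obtain ⟨c, z', hz', rfl⟩ := h' v hv
    obtain ⟨z, hz, w, hw, rfl⟩ := Submodule.mem_sup.mp hz'
    obtain ⟨d, rfl⟩ := Submodule.mem_span_singleton.mp hw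
    exact ⟨d, c, z, hz, by abel⟩

/-- If all `s ⊗ t` with `s,t` in a subspace are symmetric, the subspace has dimension at most 1. -/
theorem aux_sym_line {k V : Type*} [Field k] [AddCommGroup V] [Module k V]
    [FiniteDimensional k V] (U : Submodule k V)
    (h : ∀ s ∈ U, ∀ t ∈ U, s ⊗ₜ[k] t = t ⊗ₜ[k] s) : Module.finrank k U ≤ 1 := by
  by_cases hU : ∀ s ∈ U, s = 0
  · have : U = ⊥ := (Submodule.eq_bot_iff U).mpr hU
    subst this; simp
  · push Not at hU
    obtain ⟨s, hs, hs0⟩ := hU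
    refine finrank_le_one (⟨s, hs⟩ : U) ?_
    rintro ⟨t, ht⟩
    obtain ⟨f, hf⟩ := Module.Projective.exists_dual_ne_zero k hs0
    have e := congrArg (fun w => TensorProduct.lid k V (f.rTensor V w)) (h s hs t ht)
    simp only [LinearMap.rTensor_tmul, TensorProduct.lid_tmul] at e
    refine ⟨(f s)⁻¹ * f t, Subtype.ext ?_⟩
    change ((f s)⁻¹ * f t) • s = t
    rw [mul_smul, ← e, smul_smul, inv_mul_cancel₀ hf, one_smul]


/-- The difference of the two multiplications by `r` on `M ⊗ N`. -/
noncomputable def dK (k : Type*) {O : Type*} [Field k] [CommRing O] [Algebra k O]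
    (M N : Type*) [AddCommGroup M] [Module k M] [Module O M] [IsScalarTower k O M]
    [AddCommGroup N] [Module k N] [Module O N] [IsScalarTower k O N] (r : O) :
    M ⊗[k] N →ₗ[k] M ⊗[k] N :=
  (Algebra.lsmul k k M r).rTensor N - (Algebra.lsmul k k N r).lTensor M

section
variable {k O : Type*} [Field k] [CommRing O] [Algebra k O]
    {M N : Type*} [AddCommGroup M] [Module k M] [Module O M] [IsScalarTower k O M]
    [AddCommGroup N] [Module k N] [Module O N] [IsScalarTower k O N]
    {M' N' : Type*} [AddCommGroup M'] [Module k M'] [Module O M'] [IsScalarTower k O M']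
    [AddCommGroup N'] [Module k N'] [Module O N'] [IsScalarTower k O N']

theorem dK_tmul (r : O) (m : M) (n : N) :
    dK k M N r (m ⊗ₜ n) = (r • m) ⊗ₜ n - m ⊗ₜ (r • n) := rfl

theorem dK_comm (r s : O) (w : M ⊗[k] N) :
    dK k M N r (dK k M N s w) = dK k M N s (dK k M N r w) := by
  induction w with
  | zero => simp
  | add a b ha hb => simp only [map_add, ha, hb]
  | tmul m n =>
    simp only [dK_tmul, map_sub, smul_smul, mul_comm s r]
    abel

theorem dK_rTensor (f : M →ₗ[k] M') (hf : ∀ (r : O) m, f (r • m) = r • f m) (r : O)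
    (w : M ⊗[k] N) : f.rTensor N (dK k M N r w) = dK k M' N r (f.rTensor N w) := by
  induction w with
  | zero => simp
  | add a b ha hb => simp only [map_add, ha, hb]
  | tmul m n => simp only [dK_tmul, map_sub, LinearMap.rTensor_tmul, hf]

theorem dK_lTensor (f : N →ₗ[k] N') (hf : ∀ (r : O) m, f (r • m) = r • f m) (r : O)
    (w : M ⊗[k] N) : f.lTensor M (dK k M N r w) = dK k M N' r (f.lTensor M w) := by
  induction w with
  | zero => simp
  | add a b ha hb => simp only [map_add, ha, hb]
  | tmul m n => simp only [dK_tmul, map_sub, LinearMap.lTensor_tmul, hf]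

theorem dK_balance [IsLocalRing O]
    (hdec : ∀ r : O, ∃ c : k, r - algebraMap k O c ∈ IsLocalRing.maximalIdeal O)
    (x y : O) (hm : IsLocalRing.maximalIdeal O = Ideal.span {x, y})
    (e : ℕ) (hN : ∀ r ∈ IsLocalRing.maximalIdeal O ^ e, ∀ n : N, r • n = 0)
    (r : O) (m : M) (n : N) :
    (r • m) ⊗ₜ[k] n - m ⊗ₜ[k] (r • n) ∈
      LinearMap.range (dK k M N x) ⊔ LinearMap.range (dK k M N y) := by
  set D := LinearMap.range (dK k M N x) ⊔ LinearMap.range (dK k M N y) with hD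
  let G : O → Prop := fun r => ∀ (m : M) (n : N), (r • m) ⊗ₜ[k] n - m ⊗ₜ[k] (r • n) ∈ D
  have Gx : G x := fun m n => Submodule.mem_sup_left ⟨m ⊗ₜ n, rfl⟩
  have Gy : G y := fun m n => Submodule.mem_sup_right ⟨m ⊗ₜ n, rfl⟩
  have Gmul : ∀ r s, G r → G s → G (r * s) := by
    intro r s hr hs m n
    have := D.add_mem (hr (s • m) n) (hs m (r • n))
    rw [sub_add_sub_cancel, smul_smul, smul_smul, mul_comm s r] at this
    exact this
  have Gadd : ∀ r s, G r → G s → G (r + s) := by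
    intro r s hr hs m n
    have := D.add_mem (hr m n) (hs m n)
    rw [add_smul, add_smul, TensorProduct.add_tmul, TensorProduct.tmul_add]
    convert this using 1
    abel
  have Gc : ∀ c : k, G (algebraMap k O c) := by
    intro c m n
    rw [algebraMap_smul, algebraMap_smul, TensorProduct.smul_tmul, sub_self]
    exact D.zero_mem
  have hgen : ∀ j, IsLocalRing.maximalIdeal O ^ j ≤
      Ideal.span {p | G p ∧ p ∈ IsLocalRing.maximalIdeal O ^ j} := by
    intro j
    induction j with
    | zero =>
      have : (1 : O) ∈ Ideal.span {p | G p ∧ p ∈ IsLocalRing.maximalIdeal O ^ 0} := by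
        refine Ideal.subset_span ⟨?_, by simp⟩
        simpa using Gc 1
      rw [(Ideal.eq_top_iff_one _).mpr this]
      exact le_top
    | succ j ih =>
      rw [pow_succ]
      refine (Ideal.mul_mono ih hm.le).trans ?_
      rw [Ideal.span_mul_span', Ideal.span_le]
      rintro _ ⟨p, ⟨hp, hpm⟩, q, hq, rfl⟩
      refine Ideal.subset_span ⟨?_, ?_⟩
      · apply Gmul _ _ hp
        rcases hq with rfl | rfl
        exacts [Gx, Gy]
      · exact Ideal.mul_mem_mul hpm (hm ▸ Ideal.subset_span hq)
  have hall : ∀ i, ∀ r ∈ IsLocalRing.maximalIdeal O ^ (e - i), G r := by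
    intro i
    induction i with
    | zero =>
      intro r hr
      have hr' := hgen _ hr
      suffices h : G r ∧ r ∈ IsLocalRing.maximalIdeal O ^ e from h.1
      induction hr' using Submodule.span_induction with
      | mem p hp => exact hp
      | zero => exact ⟨by simpa using Gc 0, Ideal.zero_mem _⟩
      | add a b ha hb iha ihb =>
        have iha := iha (by exact (Ideal.span_le.mpr (fun p hp => hp.2)) ha)
        have ihb := ihb (by exact (Ideal.span_le.mpr (fun p hp => hp.2)) hb)
        exact ⟨Gadd _ _ iha.1 ihb.1, Ideal.add_mem _ iha.2 ihb.2⟩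
      | smul c p hp ih =>
        have ih := ih (by exact (Ideal.span_le.mpr (fun p hp => hp.2)) hp)
        have hcp : c • p ∈ IsLocalRing.maximalIdeal O ^ e := Ideal.mul_mem_left _ _ ih.2
        refine ⟨fun m n => ?_, hcp⟩
        have h := ih.1 (c • m) n
        rw [hN _ ih.2, TensorProduct.tmul_zero] at h
        rw [hN _ hcp, TensorProduct.tmul_zero, smul_eq_mul, mul_comm, mul_smul]
        exact h
    | succ i ihi =>
      by_cases hi : e ≤ i
      · rwa [show e - (i+1) = e - i by omega]
      intro r hr
      obtain ⟨j, hj⟩ : ∃ j, e - (i+1) = j := ⟨_, rfl⟩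
      rw [show e - i = j + 1 by omega] at ihi
      rw [hj] at hr
      have hr' := hgen _ hr
      suffices h : G r ∧ r ∈ IsLocalRing.maximalIdeal O ^ j from h.1
      induction hr' using Submodule.span_induction with
      | mem p hp => exact hp
      | zero => exact ⟨by simpa using Gc 0, Ideal.zero_mem _⟩
      | add a b ha hb iha ihb =>
        have iha := iha (by exact (Ideal.span_le.mpr (fun p hp => hp.2)) ha)
        have ihb := ihb (by exact (Ideal.span_le.mpr (fun p hp => hp.2)) hb)
        exact ⟨Gadd _ _ iha.1 ihb.1, Ideal.add_mem _ iha.2 ihb.2⟩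
      | smul c p hp ih =>
        have ih := ih (by exact (Ideal.span_le.mpr (fun p hp => hp.2)) hp)
        refine ⟨?_, Ideal.mul_mem_left _ _ ih.2⟩
        obtain ⟨κ, hκ⟩ := hdec c
        have : c • p = algebraMap k O κ * p + p * (c - algebraMap k O κ) := by
          rw [smul_eq_mul]; ring
        rw [this]
        refine Gadd _ _ (Gmul _ _ (Gc κ) ih.1) (ihi _ ?_)
        rw [pow_succ]
        exact Ideal.mul_mem_mul ih.2 hκ
  exact hall e r (by simp) m n

theorem dK_rep [IsLocalRing O]
    (hdec : ∀ r : O, ∃ c : k, r - algebraMap k O c ∈ IsLocalRing.maximalIdeal O)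
    (x y : O) (hm : IsLocalRing.maximalIdeal O = Ideal.span {x, y})
    (J : Ideal O) (e : ℕ) (he : IsLocalRing.maximalIdeal O ^ e ≤ J) (w : M ⊗[k] (O ⧸ J)) :
    ∃ m : M, w - m ⊗ₜ 1 ∈
      LinearMap.range (dK k M (O ⧸ J) x) ⊔ LinearMap.range (dK k M (O ⧸ J) y) := by
  set D := LinearMap.range (dK k M (O ⧸ J) x) ⊔ LinearMap.range (dK k M (O ⧸ J) y) with hD
  have hN : ∀ r ∈ IsLocalRing.maximalIdeal O ^ e, ∀ n : O ⧸ J, r • n = 0 := by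
    intro r hr n
    obtain ⟨n, rfl⟩ := Ideal.Quotient.mk_surjective n
    rw [← Ideal.Quotient.mk_eq_mk, ← Submodule.Quotient.mk_smul, Ideal.Quotient.mk_eq_mk,
      Ideal.Quotient.eq_zero_iff_mem]
    exact Ideal.mul_mem_right _ _ (he hr)
  induction w with
  | zero => exact ⟨0, by simp⟩
  | add a b ha hb =>
    obtain ⟨m, hm⟩ := ha
    obtain ⟨m', hm'⟩ := hb
    refine ⟨m + m', ?_⟩
    rw [TensorProduct.add_tmul, add_sub_add_comm]
    exact D.add_mem hm hm'
  | tmul m n =>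
    obtain ⟨r, rfl⟩ := Ideal.Quotient.mk_surjective n
    refine ⟨r • m, ?_⟩
    have h := dK_balance hdec x y hm e hN r m (1 : O ⧸ J)
    have h1 : r • (1 : O ⧸ J) = Ideal.Quotient.mk J r := by
      rw [Algebra.smul_def, mul_one]; rfl
    rw [h1] at h
    rw [← neg_sub]
    exact D.neg_mem h

theorem dK_corank [IsLocalRing O]
    (hdec : ∀ r : O, ∃ c : k, r - algebraMap k O c ∈ IsLocalRing.maximalIdeal O)
    (x y : O) (hm : IsLocalRing.maximalIdeal O = Ideal.span {x, y})
    (J : Ideal O) (e : ℕ) (he : IsLocalRing.maximalIdeal O ^ e ≤ J)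
    [FiniteDimensional k (O ⧸ J)] :
    Module.finrank k ((O ⧸ J) ⊗[k] (O ⧸ J)) ≤
      Module.finrank k (LinearMap.range
        ((dK k (O ⧸ J) (O ⧸ J) x).coprod (dK k (O ⧸ J) (O ⧸ J) y))) +
      Module.finrank k (O ⧸ J) := by
  rw [LinearMap.range_coprod]
  let ι : (O ⧸ J) →ₗ[k] (O ⧸ J) ⊗[k] (O ⧸ J) := (TensorProduct.mk k (O ⧸ J) (O ⧸ J)).flip 1
  have htop : (LinearMap.range (dK k (O ⧸ J) (O ⧸ J) x) ⊔
      LinearMap.range (dK k (O ⧸ J) (O ⧸ J) y)) ⊔ LinearMap.range ι = ⊤ := by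
    rw [eq_top_iff]
    intro w _
    obtain ⟨m, hw⟩ := dK_rep hdec x y hm J e he w
    have : w = (w - m ⊗ₜ 1) + ι m := by
      rw [show ι m = m ⊗ₜ 1 from rfl]; abel
    rw [this]
    exact Submodule.add_mem_sup hw ⟨m, rfl⟩
  have h1 := Submodule.finrank_add_le_finrank_add_finrank
    (LinearMap.range (dK k (O ⧸ J) (O ⧸ J) x) ⊔
      LinearMap.range (dK k (O ⧸ J) (O ⧸ J) y)) (LinearMap.range ι)
  rw [htop, finrank_top] at h1
  have h2 := LinearMap.finrank_range_le ι
  omega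

end

/-- Simple modules over a local ring with coefficient field. -/
theorem simple_struct {k O S : Type*} [Field k] [CommRing O] [Algebra k O] [IsLocalRing O]
    (hdec : ∀ r : O, ∃ c : k, r - algebraMap k O c ∈ IsLocalRing.maximalIdeal O)
    [AddCommGroup S] [Module O S] [Module k S] [IsScalarTower k O S] [IsSimpleModule O S] :
    (∀ r ∈ IsLocalRing.maximalIdeal O, ∀ s : S, r • s = 0) ∧ Module.Finite k S := by
  have hann : Module.annihilator O S = IsLocalRing.maximalIdeal O :=
    IsLocalRing.eq_maximalIdeal (IsSimpleModule.annihilator_isMaximal)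
  have h0 : ∀ r ∈ IsLocalRing.maximalIdeal O, ∀ s : S, r • s = 0 := by
    intro r hr s
    rw [← hann] at hr
    exact Module.mem_annihilator.mp hr s
  refine ⟨h0, ?_⟩
  have := IsSimpleModule.nontrivial O S
  obtain ⟨s, hs⟩ := exists_ne (0 : S)
  refine Module.Finite.of_surjective (LinearMap.toSpanSingleton k S s) fun t => ?_
  obtain ⟨r, hr⟩ := IsSimpleModule.toSpanSingleton_surjective O hs t
  obtain ⟨c, hc⟩ := hdec r
  refine ⟨c, ?_⟩
  have h := h0 _ hc s
  rw [sub_smul, algebraMap_smul, sub_eq_zero] at h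
  rw [LinearMap.toSpanSingleton_apply, ← h]
  exact hr

theorem finite_of_length {k O : Type*} [Field k] [CommRing O] [Algebra k O] [IsLocalRing O]
    (hdec : ∀ r : O, ∃ c : k, r - algebraMap k O c ∈ IsLocalRing.maximalIdeal O)
    {M : Type*} [AddCommGroup M] [Module O M] (hM : IsFiniteLength O M) :
    ∀ [Module k M] [IsScalarTower k O M], Module.Finite k M := by
  induction hM with
  | of_subsingleton => intro _ _; infer_instance
  | @of_simple_quotient M _ _ N _ hN ih =>
    intro _ _
    have h1 : Module.Finite k N := ih
    have h2 : Module.Finite k (M ⧸ N) := (simple_struct (S := M ⧸ N) hdec).2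
    have h3 : Module.Finite k ↥(N.restrictScalars k) := h1
    have h4 : Module.Finite k (M ⧸ N.restrictScalars k) := h2
    exact Module.Finite.of_submodule_quotient (N.restrictScalars k)

theorem koszul_simple {k O S : Type*} [Field k] [CommRing O] [Algebra k O]
    [AddCommGroup S] [Module O S] [Module k S] [IsScalarTower k O S]
    (x y : O) (hk : ∀ g h : O, x * g + y * h = 0 → ∃ c, g = y * c ∧ h = - (x * c))
    (hx : ∀ s : S, x • s = 0) (hy : ∀ s : S, y • s = 0) (g h : O ⊗[k] S)
    (hgh : dK k O S x g + dK k O S y h = 0) :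
    ∃ c, g = dK k O S y c ∧ h = - dK k O S x c := by
  have red : ∀ z : O, (∀ s : S, z • s = 0) → ∀ w, dK k O S z w =
      (Algebra.lsmul k k O z).rTensor S w := by
    intro z hz w
    have : Algebra.lsmul k k S z = 0 := by ext s; exact hz s
    rw [dK, this, LinearMap.lTensor_zero]
    exact sub_zero _
  let α : O →ₗ[k] O × O := (Algebra.lsmul k k O y).prod (-(Algebra.lsmul k k O x))
  let β : O × O →ₗ[k] O := (Algebra.lsmul k k O x).coprod (Algebra.lsmul k k O y)
  have hex : Function.Exact α β := by
    rintro ⟨g, h⟩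
    constructor
    · intro e
      obtain ⟨c, h1, h2⟩ := hk g h e
      exact ⟨c, Prod.ext h1.symm h2.symm⟩
    · rintro ⟨c, hc⟩
      have h1 : y * c = g := congrArg Prod.fst hc
      have h2 : - (x * c) = h := congrArg Prod.snd hc
      change x * g + y * h = 0
      rw [← h1, ← h2]; ring
  have hexS := Module.Flat.rTensor_exact S hex
  have e0 : β.rTensor S ((LinearMap.inl k O O).rTensor S g + (LinearMap.inr k O O).rTensor S h)
      = 0 := by
    rw [map_add, ← LinearMap.comp_apply, ← LinearMap.comp_apply, ← LinearMap.rTensor_comp,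
      ← LinearMap.rTensor_comp, LinearMap.coprod_inl, LinearMap.coprod_inr, ← red x hx,
      ← red y hy, hgh]
  obtain ⟨c, hc⟩ := (hexS _).mp e0
  have h1 := congrArg ((LinearMap.fst k O O).rTensor S) hc
  have h2 := congrArg ((LinearMap.snd k O O).rTensor S) hc
  simp only [map_add, ← LinearMap.comp_apply, ← LinearMap.rTensor_comp] at h1 h2
  rw [LinearMap.fst_prod, LinearMap.fst_comp_inl, LinearMap.fst_comp_inr,
    LinearMap.rTensor_id, LinearMap.rTensor_zero] at h1
  rw [LinearMap.snd_prod, LinearMap.snd_comp_inl, LinearMap.snd_comp_inr,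
    LinearMap.rTensor_id, LinearMap.rTensor_zero, LinearMap.rTensor_neg] at h2
  refine ⟨c, ?_, ?_⟩
  · rw [red y hy, h1]; simp
  · rw [red x hx, ← LinearMap.neg_apply, h2]; simp

theorem koszul_exact {k O : Type*} [Field k] [CommRing O] [Algebra k O] [IsLocalRing O]
    (hdec : ∀ r : O, ∃ c : k, r - algebraMap k O c ∈ IsLocalRing.maximalIdeal O)
    (x y : O) (hx : x ∈ IsLocalRing.maximalIdeal O) (hy : y ∈ IsLocalRing.maximalIdeal O)
    (hk : ∀ g h : O, x * g + y * h = 0 → ∃ c, g = y * c ∧ h = - (x * c))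
    {M : Type*} [AddCommGroup M] [Module O M] (hM : IsFiniteLength O M) :
    ∀ [Module k M] [IsScalarTower k O M] (g h : O ⊗[k] M),
      dK k O M x g + dK k O M y h = 0 → ∃ c, g = dK k O M y c ∧ h = - dK k O M x c := by
  induction hM with
  | of_subsingleton =>
    intro _ _ g h _
    exact ⟨0, Subsingleton.elim _ _, Subsingleton.elim _ _⟩
  | @of_simple_quotient M _ _ N _ hN ih =>
    intro _ _ g h hgh
    have hs := (simple_struct (k := k) (S := M ⧸ N) hdec).1
    let i : N →ₗ[k] M := N.subtype.restrictScalars k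
    let π : M →ₗ[k] M ⧸ N := N.mkQ.restrictScalars k
    have hi : ∀ (r : O) n, i (r • n) = r • i n := fun _ _ => rfl
    have hπ : ∀ (r : O) n, π (r • n) = r • π n := fun _ _ => rfl
    have hπs : Function.Surjective π := N.mkQ_surjective
    have hex : Function.Exact i π := LinearMap.exact_subtype_mkQ N
    have hexO := lTensor_exact O hex hπs
    have hsurj := LinearMap.lTensor_surjective O hπs
    have hinj : Function.Injective (i.lTensor O) :=
      Module.Flat.lTensor_preserves_injective_linearMap i N.subtype_injective
    have h1 := congrArg (π.lTensor O) hgh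
    rw [map_add, dK_lTensor π hπ, dK_lTensor π hπ, map_zero] at h1
    obtain ⟨c0, hc1, hc2⟩ := koszul_simple x y hk (hs x hx) (hs y hy) _ _ h1
    obtain ⟨c, rfl⟩ := hsurj c0
    rw [← dK_lTensor π hπ, ← sub_eq_zero, ← map_sub] at hc1
    rw [← dK_lTensor π hπ, eq_neg_iff_add_eq_zero, ← map_add] at hc2
    obtain ⟨g1, hg1⟩ := (hexO _).mp hc1
    obtain ⟨h1, hh1⟩ := (hexO _).mp hc2
    have e : dK k O N x g1 + dK k O N y h1 = 0 := by
      apply hinj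
      rw [map_add, dK_lTensor i hi, dK_lTensor i hi, hg1, hh1, map_sub, map_add, dK_comm y x c,
        map_zero, ← hgh]
      abel
    obtain ⟨d, hd1, hd2⟩ := ih g1 h1 e
    refine ⟨c + i.lTensor O d, ?_, ?_⟩
    · rw [map_add, ← dK_lTensor i hi, ← hd1, hg1]; abel
    · have : i.lTensor O (dK k O N x d) = - i.lTensor O h1 := by rw [hd2, map_neg, neg_neg]
      rw [map_add, ← dK_lTensor i hi, this, hh1]; abel

theorem aux_dim {k Z V X : Type*} [Field k] [AddCommGroup Z] [Module k Z] [AddCommGroup V]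
    [Module k V] [AddCommGroup X] [Module k X] [FiniteDimensional k V] [FiniteDimensional k X]
    (p : Z →ₗ[k] V) (f : Z →ₗ[k] X) (Y K : Submodule k V) (hY : ∀ y ∈ Y, ∃ z, p z = y)
    (hf : ∀ z, f z = 0 → p z ∈ K) :
    Module.finrank k Y ≤ Module.finrank k X + Module.finrank k K := by
  let q : Z →ₗ[k] V ⧸ K := K.mkQ ∘ₗ p
  have hle : LinearMap.ker f ≤ LinearMap.ker q := by
    intro z hz
    rw [LinearMap.mem_ker, LinearMap.comp_apply, Submodule.mkQ_apply,
      Submodule.Quotient.mk_eq_zero]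
    exact hf z hz
  have : Module.Finite k (Z ⧸ LinearMap.ker f) :=
    Module.Finite.equiv f.quotKerEquivRange.symm
  have h1 := LinearMap.finrank_range_le ((LinearMap.ker f).liftQ q hle)
  rw [Submodule.range_liftQ, f.quotKerEquivRange.finrank_eq] at h1
  have h2 := Submodule.finrank_le (LinearMap.range f)
  have h3 := LinearMap.finrank_range_add_finrank_ker (K.mkQ ∘ₗ Y.subtype)
  have h4 : LinearMap.range (K.mkQ ∘ₗ Y.subtype) ≤ LinearMap.range q := by
    rintro _ ⟨⟨v, hv⟩, rfl⟩
    obtain ⟨z, hz⟩ := hY v hv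
    exact ⟨z, by simp [q, hz]⟩
  have h5 := Submodule.finrank_mono h4
  have h6 : Module.finrank k (LinearMap.ker (K.mkQ ∘ₗ Y.subtype)) ≤ Module.finrank k K := by
    refine LinearMap.finrank_le_finrank_of_injective
      (f := (Y.subtype ∘ₗ (LinearMap.ker (K.mkQ ∘ₗ Y.subtype)).subtype).codRestrict K ?_) ?_
    · rintro ⟨v, hv⟩
      rw [LinearMap.mem_ker, LinearMap.comp_apply, Submodule.mkQ_apply,
        Submodule.Quotient.mk_eq_zero] at hv
      exact hv
    · intro a b hab
      have h0 := congrArg (fun t : K => (t : V)) hab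
      exact Subtype.ext (Subtype.ext h0)
  omega

/-- The map `J ⊗ O/J → J/J²`. -/
noncomputable def cotMap (k : Type*) {O : Type*} [Field k] [CommRing O] [Algebra k O]
    (J : Ideal O) : J ⊗[k] (O ⧸ J) →ₗ[k] J.Cotangent :=
  TensorProduct.lift (LinearMap.mk₂ k (fun (j : J) (a : O ⧸ J) => a • J.toCotangent j)
    (fun a b c => by rw [map_add, smul_add])
    (fun c j a => by
      obtain ⟨r, rfl⟩ := Ideal.Quotient.mk_surjective a
      have h1 : c • j = algebraMap k O c • j := (algebraMap_smul O c j).symm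
      have h2 : c • (r • J.toCotangent j) = algebraMap k O c • (r • J.toCotangent j) :=
        (algebraMap_smul O c _).symm
      change r • J.toCotangent (c • j) = c • (r • J.toCotangent j)
      rw [h1, h2, map_smul, smul_comm])
    (fun a b c => by rw [add_smul])
    (fun c j a => by
      obtain ⟨r, rfl⟩ := Ideal.Quotient.mk_surjective a
      have h1 : c • (Ideal.Quotient.mk J r) = Ideal.Quotient.mk J (c • r) := rfl
      rw [h1]
      change (c • r) • J.toCotangent j = c • (r • J.toCotangent j)
      rw [smul_assoc]))

theorem cotMap_tmul {k O : Type*} [Field k] [CommRing O] [Algebra k O]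
    (J : Ideal O) (j : J) (r : O) :
    cotMap k J (j ⊗ₜ Ideal.Quotient.mk J r) = r • J.toCotangent j := rfl

theorem cotMap_dK {k O : Type*} [Field k] [CommRing O] [Algebra k O]
    (J : Ideal O) (r : O) (w : J ⊗[k] (O ⧸ J)) : cotMap k J (dK k J (O ⧸ J) r w) = 0 := by
  induction w with
  | zero => simp
  | add a b ha hb => rw [map_add, map_add, ha, hb, add_zero]
  | tmul j a =>
    obtain ⟨s, rfl⟩ := Ideal.Quotient.mk_surjective a
    rw [dK_tmul, map_sub, cotMap_tmul, map_smul,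
      show r • Ideal.Quotient.mk J s = Ideal.Quotient.mk J (r * s) from rfl, cotMap_tmul, smul_smul,
      mul_comm, sub_self]

theorem cotMap_ker {k O : Type*} [Field k] [CommRing O] [Algebra k O] [IsLocalRing O]
    (hdec : ∀ r : O, ∃ c : k, r - algebraMap k O c ∈ IsLocalRing.maximalIdeal O)
    (x y : O) (hm : IsLocalRing.maximalIdeal O = Ideal.span {x, y})
    (J : Ideal O) (e : ℕ) (he : IsLocalRing.maximalIdeal O ^ e ≤ J)
    (w : J ⊗[k] (O ⧸ J)) (hw : cotMap k J w = 0) :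
    ∃ a b, w = dK k J (O ⧸ J) x a + dK k J (O ⧸ J) y b := by
  suffices h : w ∈ LinearMap.range (dK k J (O ⧸ J) x) ⊔ LinearMap.range (dK k J (O ⧸ J) y) by
    obtain ⟨_, ⟨a, rfl⟩, _, ⟨b, rfl⟩, h⟩ := Submodule.mem_sup.mp h
    exact ⟨a, b, h.symm⟩
  set D := LinearMap.range (dK k J (O ⧸ J) x) ⊔ LinearMap.range (dK k J (O ⧸ J) y) with hD
  have hDk : ∀ z ∈ D, cotMap k J z = 0 := by
    intro z hz
    obtain ⟨_, ⟨a, rfl⟩, _, ⟨b, rfl⟩, rfl⟩ := Submodule.mem_sup.mp hz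
    rw [map_add, cotMap_dK, cotMap_dK, add_zero]
  obtain ⟨⟨j, hj⟩, hjw⟩ := dK_rep (M := J) hdec x y hm J e he w
  have h1 := hDk _ hjw
  rw [map_sub, hw, zero_sub, neg_eq_zero] at h1
  have h2 : J.toCotangent ⟨j, hj⟩ = 0 := by
    rw [← one_smul O (J.toCotangent _), ← cotMap_tmul (k := k), map_one, h1]
  rw [Ideal.toCotangent_eq_zero, pow_two] at h2
  have hN : ∀ r ∈ IsLocalRing.maximalIdeal O ^ e, ∀ n : O ⧸ J, r • n = 0 := by
    intro r hr n
    obtain ⟨n, rfl⟩ := Ideal.Quotient.mk_surjective n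
    change Ideal.Quotient.mk J (r * n) = 0
    rw [Ideal.Quotient.eq_zero_iff_mem]
    exact Ideal.mul_mem_right _ _ (he hr)
  have h3 : ∀ z ∈ J * J, ∃ hz : z ∈ J, (⟨z, hz⟩ : J) ⊗ₜ[k] (1 : O ⧸ J) ∈ D := by
    intro z hz
    induction hz using Submodule.mul_induction_on' with
    | mem_mul_mem a ha b hb =>
      refine ⟨Ideal.mul_mem_left _ _ hb, ?_⟩
      have := dK_balance hdec x y hm e hN a (⟨b, hb⟩ : J) (1 : O ⧸ J)
      have h0 : a • (1 : O ⧸ J) = 0 := by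
        change Ideal.Quotient.mk J (a * 1) = 0
        rw [Ideal.Quotient.eq_zero_iff_mem, mul_one]
        exact ha
      rw [h0, TensorProduct.tmul_zero, sub_zero] at this
      exact this
    | add a _ b _ iha ihb =>
      obtain ⟨ha, ha'⟩ := iha
      obtain ⟨hb, hb'⟩ := ihb
      refine ⟨J.add_mem ha hb, ?_⟩
      have := D.add_mem ha' hb'
      rw [← TensorProduct.add_tmul] at this
      exact this
  obtain ⟨_, h4⟩ := h3 j h2
  have := D.add_mem hjw h4
  rwa [sub_add_cancel] at this

theorem cot_lower {k O : Type*} [Field k] [CommRing O] [Algebra k O] [IsLocalRing O]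
    (hdec : ∀ r : O, ∃ c : k, r - algebraMap k O c ∈ IsLocalRing.maximalIdeal O)
    (x y : O) (hm : IsLocalRing.maximalIdeal O = Ideal.span {x, y})
    (hk : ∀ g h : O, x * g + y * h = 0 → ∃ c, g = y * c ∧ h = - (x * c))
    (J : Ideal O) (e : ℕ) (he : IsLocalRing.maximalIdeal O ^ e ≤ J)
    (hA : IsFiniteLength O (O ⧸ J)) [FiniteDimensional k (O ⧸ J)]
    [FiniteDimensional k J.Cotangent] :
    Module.finrank k (O ⧸ J) + Module.finrank k ↥(LinearMap.ker (dK k (O ⧸ J) (O ⧸ J) x) ⊓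
      LinearMap.ker (dK k (O ⧸ J) (O ⧸ J) y)) ≤ Module.finrank k J.Cotangent := by
  have hx : x ∈ IsLocalRing.maximalIdeal O := hm ▸ Ideal.subset_span (by simp)
  have hy : y ∈ IsLocalRing.maximalIdeal O := hm ▸ Ideal.subset_span (by simp)
  set u := dK k (O ⧸ J) (O ⧸ J) x with hu
  set v := dK k (O ⧸ J) (O ⧸ J) y with hv
  let i : J →ₗ[k] O := J.subtype.restrictScalars k
  let π : O →ₗ[k] O ⧸ J := (Submodule.mkQ J).restrictScalars k
  have hi : ∀ (r : O) n, i (r • n) = r • i n := fun _ _ => rfl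
  have hπ : ∀ (r : O) n, π (r • n) = r • π n := fun _ _ => rfl
  have hπs : Function.Surjective π := Submodule.mkQ_surjective J
  have hex : Function.Exact i π := LinearMap.exact_subtype_mkQ J
  have hexA := rTensor_exact (O ⧸ J) hex hπs
  have hsurj := LinearMap.rTensor_surjective (O ⧸ J) hπs
  let E := i.rTensor (O ⧸ J)
  let PP := π.rTensor (O ⧸ J)
  have hPPE : ∀ w, PP (E w) = 0 := fun w => (hexA _).mpr ⟨w, rfl⟩
  let Φ : (O ⊗[k] (O ⧸ J)) × (O ⊗[k] (O ⧸ J)) × (J ⊗[k] (O ⧸ J)) →ₗ[k] O ⊗[k] (O ⧸ J) :=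
    (dK k O (O ⧸ J) x).coprod ((dK k O (O ⧸ J) y).coprod (-E))
  have hΦ : ∀ g h w, Φ (g, h, w) = dK k O (O ⧸ J) x g + (dK k O (O ⧸ J) y h + -E w) :=
    fun _ _ _ => rfl
  let Z := LinearMap.ker Φ
  let p0 : (O ⊗[k] (O ⧸ J)) × (O ⊗[k] (O ⧸ J)) × (J ⊗[k] (O ⧸ J)) →ₗ[k] 
    ((O ⧸ J) ⊗[k] (O ⧸ J)) × ((O ⧸ J) ⊗[k] (O ⧸ J)) :=
    (PP ∘ₗ LinearMap.fst k _ _).prod (PP ∘ₗ LinearMap.fst k _ _ ∘ₗ LinearMap.snd k _ _)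
  let f0 : (O ⊗[k] (O ⧸ J)) × (O ⊗[k] (O ⧸ J)) × (J ⊗[k] (O ⧸ J)) →ₗ[k] J.Cotangent :=
    cotMap k J ∘ₗ LinearMap.snd k _ _ ∘ₗ LinearMap.snd k _ _
  have key := aux_dim (Z := Z) (p0 ∘ₗ Z.subtype) (f0 ∘ₗ Z.subtype) (LinearMap.ker (u.coprod v))
    (LinearMap.range (v.prod (-u))) ?_ ?_
  · have h1 := LinearMap.finrank_range_add_finrank_ker (u.coprod v)
    have h2 := LinearMap.finrank_range_add_finrank_ker (v.prod (-u))
    rw [Module.finrank_prod] at h1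
    have h3 : LinearMap.ker (v.prod (-u)) = LinearMap.ker u ⊓ LinearMap.ker v := by
      ext w
      change (v w, -(u w)) = 0 ↔ u w = 0 ∧ v w = 0
      rw [Prod.mk_eq_zero, neg_eq_zero]
      exact and_comm
    rw [h3] at h2
    let μ := LinearMap.mul' k (O ⧸ J)
    have h4 : LinearMap.range (u.coprod v) ≤ LinearMap.ker μ := by
      have hz : ∀ (r : O) w, μ (dK k (O ⧸ J) (O ⧸ J) r w) = 0 := by
        intro r w
        induction w with
        | zero => simp
        | add a b ha hb => rw [map_add, map_add, ha, hb, add_zero]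
        | tmul a b =>
          rw [dK_tmul, map_sub, LinearMap.mul'_apply, LinearMap.mul'_apply, smul_mul_assoc,
            mul_smul_comm, sub_self]
      rintro _ ⟨⟨a, b⟩, rfl⟩
      rw [LinearMap.mem_ker, LinearMap.coprod_apply, map_add, hz, hz, add_zero]
    have h5 := Submodule.finrank_mono h4
    have h6 := LinearMap.finrank_range_add_finrank_ker μ
    have h7 : LinearMap.range μ = ⊤ := by
      rw [LinearMap.range_eq_top]
      intro a
      exact ⟨a ⊗ₜ 1, by rw [LinearMap.mul'_apply, mul_one]⟩
    rw [h7, finrank_top] at h6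
    omega
  · rintro ⟨g0, h0⟩ hgh
    obtain ⟨g, rfl⟩ := hsurj g0
    obtain ⟨h, rfl⟩ := hsurj h0
    rw [LinearMap.mem_ker, LinearMap.coprod_apply] at hgh
    simp only [hu, hv] at hgh
    rw [← dK_rTensor π hπ, ← dK_rTensor π hπ, ← map_add] at hgh
    obtain ⟨w, hw⟩ := (hexA _).mp hgh
    refine ⟨⟨(g, h, w), ?_⟩, rfl⟩
    change Φ (g, h, w) = 0
    rw [hΦ, show E w = _ from hw]
    abel
  · rintro ⟨⟨g, h, w⟩, hz⟩ hw
    change cotMap k J w = 0 at hw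
    change Φ (g, h, w) = 0 at hz
    obtain ⟨a, b, rfl⟩ := cotMap_ker hdec x y hm J e he w hw
    rw [hΦ, map_add, dK_rTensor i hi, dK_rTensor i hi] at hz
    obtain ⟨c, hc1, hc2⟩ := koszul_exact hdec x y hx hy hk hA (g - E a) (h - E b) (by
      rw [map_sub, map_sub, ← hz]
      change _ = _ + (_ + -(dK k O (O ⧸ J) x (E a) + dK k O (O ⧸ J) y (E b)))
      abel)
    have d1 := congrArg PP hc1
    have d2 := congrArg PP hc2
    rw [map_sub, hPPE, sub_zero, dK_rTensor π hπ] at d1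
    rw [map_sub, hPPE, sub_zero, map_neg, dK_rTensor π hπ] at d2
    exact ⟨PP c, Prod.ext d1.symm d2.symm⟩

theorem sym_socle {k O : Type*} [Field k] [CommRing O] [Algebra k O] [IsLocalRing O]
    (hdec : ∀ r : O, ∃ c : k, r - algebraMap k O c ∈ IsLocalRing.maximalIdeal O)
    (x y : O) (hm : IsLocalRing.maximalIdeal O = Ideal.span {x, y})
    (J : Ideal O) (e : ℕ) (he : IsLocalRing.maximalIdeal O ^ e ≤ J)
    [FiniteDimensional k (O ⧸ J)] :
    Module.finrank k (O ⧸ J) ≤ Module.finrank k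
      ↥(LinearMap.ker (LinearMap.id - (TensorProduct.comm k (O ⧸ J) (O ⧸ J)).toLinearMap) ⊓
        LinearMap.ker (dK k (O ⧸ J) (O ⧸ J) x) ⊓ LinearMap.ker (dK k (O ⧸ J) (O ⧸ J) y)) := by
  have hlr : ∀ (a b : O) (w : (O ⧸ J) ⊗[k] (O ⧸ J)),
      (Algebra.lsmul k k (O ⧸ J) a).rTensor (O ⧸ J)
        ((Algebra.lsmul k k (O ⧸ J) b).lTensor (O ⧸ J) w) =
      (Algebra.lsmul k k (O ⧸ J) b).lTensor (O ⧸ J)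
        ((Algebra.lsmul k k (O ⧸ J) a).rTensor (O ⧸ J) w) := by
    intro a b w
    induction w with
    | zero => simp
    | add a b ha hb => simp only [map_add, ha, hb]
    | tmul a b => rfl
  have hτ1 : ∀ (a : O) (w : (O ⧸ J) ⊗[k] (O ⧸ J)),
      (TensorProduct.comm k (O ⧸ J) (O ⧸ J)).toLinearMap
        ((Algebra.lsmul k k (O ⧸ J) a).rTensor (O ⧸ J) w) =
      (Algebra.lsmul k k (O ⧸ J) a).lTensor (O ⧸ J)
        ((TensorProduct.comm k (O ⧸ J) (O ⧸ J)).toLinearMap w) := by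
    intro a w
    induction w with
    | zero => simp
    | add a b ha hb => simp only [map_add, ha, hb]
    | tmul a b => rfl
  have hτ2 : ∀ (a : O) (w : (O ⧸ J) ⊗[k] (O ⧸ J)),
      (TensorProduct.comm k (O ⧸ J) (O ⧸ J)).toLinearMap
        ((Algebra.lsmul k k (O ⧸ J) a).lTensor (O ⧸ J) w) =
      (Algebra.lsmul k k (O ⧸ J) a).rTensor (O ⧸ J)
        ((TensorProduct.comm k (O ⧸ J) (O ⧸ J)).toLinearMap w) := by
    intro a w
    induction w with
    | zero => simp
    | add a b ha hb => simp only [map_add, ha, hb]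
    | tmul a b => rfl
  refine aux_lin (TensorProduct.comm k (O ⧸ J) (O ⧸ J)).toLinearMap
    ((Algebra.lsmul k k (O ⧸ J) x).rTensor (O ⧸ J))
    ((Algebra.lsmul k k (O ⧸ J) y).rTensor (O ⧸ J))
    ((Algebra.lsmul k k (O ⧸ J) x).lTensor (O ⧸ J))
    ((Algebra.lsmul k k (O ⧸ J) y).lTensor (O ⧸ J))
    ?_ (hτ1 x) (hτ1 y) (hτ2 y) ?_ (hlr x y) (fun w => (hlr y x w).symm) _ aux_sym_dim
    (dK_corank hdec x y hm J e he)
  · intro w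
    induction w with
    | zero => simp
    | add a b ha hb => simp only [map_add, ha, hb]
    | tmul a b => rfl
  · intro w
    induction w with
    | zero => simp
    | add a b ha hb => simp only [map_add, ha, hb]
    | tmul a b =>
      simp only [LinearMap.rTensor_tmul, Algebra.lsmul_coe]
      rw [smul_comm]

theorem ci_of_socle {k O : Type*} [Field k] [CommRing O] [Algebra k O] [IsLocalRing O]
    [IsNoetherianRing O]
    (hdec : ∀ r : O, ∃ c : k, r - algebraMap k O c ∈ IsLocalRing.maximalIdeal O)
    (x y : O) (hm : IsLocalRing.maximalIdeal O = Ideal.span {x, y})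
    (J : Ideal O) (hJm : J ≤ IsLocalRing.maximalIdeal O) [FiniteDimensional k (O ⧸ J)]
    (hsoc : Module.finrank k ↥(LinearMap.ker (Algebra.lsmul k k (O ⧸ J) x) ⊓
      LinearMap.ker (Algebra.lsmul k k (O ⧸ J) y)) ≤ 1) :
    ∃ g1 g2 : O, J = Ideal.span {g1, g2} := by
  have hx : x ∈ IsLocalRing.maximalIdeal O := hm ▸ Ideal.subset_span (by simp)
  have hy : y ∈ IsLocalRing.maximalIdeal O := hm ▸ Ideal.subset_span (by simp)
  let X : (O ⧸ J) →ₗ[k] (O ⧸ J) := Algebra.lsmul k k (O ⧸ J) x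
  let Y : (O ⧸ J) →ₗ[k] (O ⧸ J) := Algebra.lsmul k k (O ⧸ J) y
  have hX : ∀ r, X (Ideal.Quotient.mk J r) = Ideal.Quotient.mk J (x * r) := fun _ => rfl
  have hY : ∀ r, Y (Ideal.Quotient.mk J r) = Ideal.Quotient.mk J (y * r) := fun _ => rfl
  have hc : ∀ (c : k) r, c • (Ideal.Quotient.mk J r) =
      Ideal.Quotient.mk J (algebraMap k O c * r) := by
    intro c r
    rw [← Algebra.smul_def]; rfl
  have h1 := LinearMap.finrank_range_add_finrank_ker (X.coprod Y)
  have h2 := LinearMap.finrank_range_add_finrank_ker (Y.prod (-X))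
  rw [Module.finrank_prod] at h1
  have h3 : LinearMap.ker (Y.prod (-X)) = LinearMap.ker X ⊓ LinearMap.ker Y := by
    ext w
    change (Y w, -(X w)) = 0 ↔ X w = 0 ∧ Y w = 0
    rw [Prod.mk_eq_zero, neg_eq_zero]
    exact and_comm
  rw [h3] at h2
  have hsoc' : Module.finrank k ↥(LinearMap.ker X ⊓ LinearMap.ker Y) ≤ 1 := hsoc
  have htop : LinearMap.range (X.coprod Y) ⊔ Submodule.span k {(1 : O ⧸ J)} = ⊤ := by
    rw [eq_top_iff]
    intro a _
    obtain ⟨r, rfl⟩ := Ideal.Quotient.mk_surjective a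
    obtain ⟨c, hcr⟩ := hdec r
    rw [hm] at hcr
    obtain ⟨p, q, hpq⟩ := Ideal.mem_span_pair.mp hcr
    have : Ideal.Quotient.mk J r = X.coprod Y (Ideal.Quotient.mk J p, Ideal.Quotient.mk J q) +
        c • (1 : O ⧸ J) := by
      rw [LinearMap.coprod_apply, hX, hY, ← map_one (Ideal.Quotient.mk J), hc, ← map_add,
        ← map_add]
      congr 1
      linear_combination -hpq
    rw [this]
    exact Submodule.add_mem_sup ⟨_, rfl⟩
      (Submodule.smul_mem _ _ (Submodule.mem_span_singleton_self _))
  have h4 := Submodule.finrank_add_le_finrank_add_finrank (LinearMap.range (X.coprod Y))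
    (Submodule.span k {(1 : O ⧸ J)})
  rw [htop, finrank_top] at h4
  have h5 : Module.finrank k (Submodule.span k {(1 : O ⧸ J)}) ≤ 1 := by
    have := finrank_span_le_card (R := k) ({(1 : O ⧸ J)} : Set (O ⧸ J))
    simpa using this
  have hXY : ∀ z, X (Y z) = Y (X z) := by
    intro z
    obtain ⟨r, rfl⟩ := Ideal.Quotient.mk_surjective z
    rw [hX, hY, hX, hY]
    congr 1
    ring
  obtain ⟨e1, he1, e2, he2, hgen⟩ := aux_two_gen (LinearMap.range (Y.prod (-X)))
    (LinearMap.ker (X.coprod Y)) (by omega) (by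
      rintro _ ⟨z, rfl⟩
      change X (Y z) + Y (-(X z)) = 0
      rw [map_neg, hXY, add_neg_cancel])
  obtain ⟨a1, b1⟩ := e1
  obtain ⟨a2, b2⟩ := e2
  obtain ⟨a1, rfl⟩ := Ideal.Quotient.mk_surjective a1
  obtain ⟨b1, rfl⟩ := Ideal.Quotient.mk_surjective b1
  obtain ⟨a2, rfl⟩ := Ideal.Quotient.mk_surjective a2
  obtain ⟨b2, rfl⟩ := Ideal.Quotient.mk_surjective b2
  rw [LinearMap.mem_ker, LinearMap.coprod_apply, hX, hY, ← map_add,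
    Ideal.Quotient.eq_zero_iff_mem] at he1 he2
  refine ⟨x * a1 + y * b1, x * a2 + y * b2, le_antisymm ?_ ?_⟩
  · refine Submodule.le_of_le_smul_of_le_jacobson_bot (I := IsLocalRing.maximalIdeal O)
      (IsNoetherian.noetherian J) ?_ ?_
    · rw [IsLocalRing.jacobson_eq_maximalIdeal _ bot_ne_top]
    · intro j hj
      have hjm := hJm hj
      rw [hm] at hjm
      obtain ⟨p, q, hpq⟩ := Ideal.mem_span_pair.mp hjm
      obtain ⟨c1, c2, _, ⟨z, rfl⟩, hz⟩ := hgen (Ideal.Quotient.mk J p, Ideal.Quotient.mk J q) (by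
        rw [LinearMap.mem_ker, LinearMap.coprod_apply, hX, hY, ← map_add,
          Ideal.Quotient.eq_zero_iff_mem]
        rw [mul_comm x, mul_comm y, hpq]
        exact hj)
      obtain ⟨s, rfl⟩ := Ideal.Quotient.mk_surjective z
      have z1 : Ideal.Quotient.mk J p = c1 • Ideal.Quotient.mk J a1 + c2 • Ideal.Quotient.mk J a2
        + Y (Ideal.Quotient.mk J s) := congrArg Prod.fst hz
      have z2 : Ideal.Quotient.mk J q = c1 • Ideal.Quotient.mk J b1 + c2 • Ideal.Quotient.mk J b2
        + -X (Ideal.Quotient.mk J s) := congrArg Prod.snd hz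
      rw [hc, hc, hY, ← map_add, ← map_add, Ideal.Quotient.eq] at z1
      rw [hc, hc, hX, ← map_neg, ← map_add, ← map_add, Ideal.Quotient.eq] at z2
      have : j = (algebraMap k O c1 * (x * a1 + y * b1) + algebraMap k O c2 * (x * a2 + y * b2))
        + (x * (p - (algebraMap k O c1 * a1 + algebraMap k O c2 * a2 + y * s)) +
          y * (q - (algebraMap k O c1 * b1 + algebraMap k O c2 * b2 + -(x * s)))) := by
        linear_combination -hpq
      rw [this]
      refine Submodule.add_mem_sup (Ideal.mem_span_pair.mpr ⟨_, _, rfl⟩) ?_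
      exact Submodule.add_mem _ (Submodule.smul_mem_smul hx z1) (Submodule.smul_mem_smul hy z2)
  · rw [Ideal.span_le]
    rintro _ (rfl | rfl)
    exacts [he1, he2]

theorem cot_upper {k O : Type*} [Field k] [CommRing O] [Algebra k O]
    (a b : O) (J : Ideal O) (hJ : J = Ideal.span {a, b}) [FiniteDimensional k (O ⧸ J)] :
    Module.finrank k J.Cotangent ≤ 2 * Module.finrank k (O ⧸ J) := by
  have ha : a ∈ J := hJ ▸ Ideal.subset_span (by simp)
  have hb : b ∈ J := hJ ▸ Ideal.subset_span (by simp)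
  let F : (O ⧸ J) × (O ⧸ J) →ₗ[k] J.Cotangent :=
    (cotMap k J ∘ₗ TensorProduct.mk k J (O ⧸ J) ⟨a, ha⟩).coprod
      (cotMap k J ∘ₗ TensorProduct.mk k J (O ⧸ J) ⟨b, hb⟩)
  have hF : LinearMap.range F = ⊤ := by
    rw [LinearMap.range_eq_top]
    intro t
    obtain ⟨⟨j, hj⟩, rfl⟩ := J.toCotangent_surjective t
    have hj' := hj
    rw [hJ] at hj'
    obtain ⟨p, q, hpq⟩ := Ideal.mem_span_pair.mp hj'
    refine ⟨(Ideal.Quotient.mk J p, Ideal.Quotient.mk J q), ?_⟩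
    change p • J.toCotangent ⟨a, ha⟩ + q • J.toCotangent ⟨b, hb⟩ = _
    rw [← map_smul, ← map_smul, ← map_add]
    congr 1
    exact Subtype.ext hpq
  have h := LinearMap.finrank_range_le F
  rw [hF, finrank_top, Module.finrank_prod] at h
  omega

theorem cot_finite {k O : Type*} [Field k] [CommRing O] [Algebra k O] [IsNoetherianRing O]
    (J : Ideal O) [FiniteDimensional k (O ⧸ J)] : Module.Finite k J.Cotangent := by
  have h1 : Module.Finite O J.Cotangent :=
    Module.Finite.of_surjective J.toCotangent J.toCotangent_surjective
  have h2 : Module.Finite (O ⧸ J) J.Cotangent :=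
    Module.Finite.of_restrictScalars_finite O (O ⧸ J) J.Cotangent
  have h3 : IsScalarTower k (O ⧸ J) J.Cotangent := by
    constructor
    intro c a t
    obtain ⟨r, rfl⟩ := Ideal.Quotient.mk_surjective a
    change (c • r) • t = c • (r • t)
    rw [smul_assoc]
  exact Module.Finite.trans (O ⧸ J) J.Cotangent


theorem cotangent_dim_ge_two_mul_colength
    (k : Type) [Field k]
    (O : Type) [CommRing O] [IsLocalRing O] [IsNoetherianRing O]
    [Algebra k O]
    -- k maps isomorphically onto the residue field O/m:
    (hres : Function.Bijective ((IsLocalRing.residue O).comp (algebraMap k O)))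
    -- O is regular of dimension 2:
    (hdim : ringKrullDim O = 2)
    (hreg : ∃ x y : O, IsLocalRing.maximalIdeal O = Ideal.span {x, y})
    (J : Ideal O)
    -- J has height two:
    (hht : idealHeight J = 2) :
    2 * Module.finrank k (O ⧸ J) ≤ Module.finrank k J.Cotangent ∧
    (Module.finrank k J.Cotangent = 2 * Module.finrank k (O ⧸ J) ↔
      ∃ x y : O, J = Ideal.span {x, y} ∧ RingTheory.Sequence.IsRegular O [x, y]) := by
  obtain ⟨x, y, hm⟩ := hreg
  have hx : x ∈ IsLocalRing.maximalIdeal O := hm ▸ Ideal.subset_span (by simp)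
  have hy : y ∈ IsLocalRing.maximalIdeal O := hm ▸ Ideal.subset_span (by simp)
  obtain ⟨-, -, hk⟩ := aux_regular hdim x y hm
  have hdec : ∀ r : O, ∃ c : k, r - algebraMap k O c ∈ IsLocalRing.maximalIdeal O := by
    intro r
    obtain ⟨c, hc⟩ := hres.2 (IsLocalRing.residue O r)
    refine ⟨c, ?_⟩
    rw [← IsLocalRing.residue_eq_zero_iff, map_sub, ← hc]
    exact sub_self _
  -- the maximal ideal is the only prime containing `J`
  have hhm : Order.height (IsLocalRing.closedPoint O) = 2 := by
    have h1 := IsLocalRing.maximalIdeal_height_eq_ringKrullDim (R := O)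
    rw [hdim] at h1
    have h2 : (IsLocalRing.maximalIdeal O).height = 2 := WithBot.coe_injective (h1.trans rfl)
    rw [← PrimeSpectrum.height_eq_orderHeight]
    exact h2
  have hprime : ∀ P : PrimeSpectrum O, J ≤ P.asIdeal → P = IsLocalRing.closedPoint O := by
    intro P hP
    by_contra hne
    have hle : P ≤ IsLocalRing.closedPoint O := IsLocalRing.le_maximalIdeal P.isPrime.ne_top
    have hlt : P < IsLocalRing.closedPoint O := lt_of_le_of_ne hle hne
    have h1 := Order.height_add_one_le hlt
    have h2 : (2 : ℕ∞) ≤ Order.height P := by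
      rw [← hht]
      exact iInf₂_le P hP
    rw [hhm] at h1
    have h3 : (2 : ℕ∞) + 1 ≤ 2 := (add_le_add_left h2 1).trans h1
    exact absurd h3 (by decide)
  have hJtop : J ≠ ⊤ := by
    rintro rfl
    have : idealHeight (⊤ : Ideal O) = ⊤ := by
      unfold idealHeight
      refine iInf₂_eq_top.mpr fun P hP => ?_
      exact absurd (top_le_iff.mp hP) P.isPrime.ne_top
    rw [this] at hht
    exact absurd hht (by decide)
  have hJm : J ≤ IsLocalRing.maximalIdeal O := IsLocalRing.le_maximalIdeal hJtop
  have hmin : IsLocalRing.maximalIdeal O ∈ J.minimalPrimes := by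
    refine ⟨⟨inferInstance, hJm⟩, ?_⟩
    rintro q ⟨hq, hJq⟩ -
    exact (congrArg PrimeSpectrum.asIdeal (hprime ⟨q, hq⟩ hJq)).ge
  have hart : IsArtinianRing (O ⧸ J) :=
    IsLocalRing.quotient_artinian_of_mem_minimalPrimes_of_isLocalRing J hmin
  obtain ⟨e, he⟩ : ∃ e, IsLocalRing.maximalIdeal O ^ e ≤ J := by
    obtain ⟨n, hn⟩ := Ideal.exists_radical_pow_le_of_fg J (IsNoetherian.noetherian _)
    refine ⟨n, (Ideal.pow_right_mono ?_ n).trans hn⟩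
    rw [Ideal.radical_eq_sInf]
    refine le_sInf ?_
    rintro q ⟨hJq, hq⟩
    exact hmin.2 ⟨hq, hJq⟩ (IsLocalRing.le_maximalIdeal hq.ne_top)
  have hlen : IsFiniteLength O (O ⧸ J) := by
    rw [isFiniteLength_iff_isNoetherian_isArtinian]
    refine ⟨inferInstance, ?_⟩
    exact isArtinian_of_surjective_algebraMap (S := O) (R := O ⧸ J) Ideal.Quotient.mk_surjective
  have hfin : FiniteDimensional k (O ⧸ J) := finite_of_length hdec hlen
  have hfinC : FiniteDimensional k J.Cotangent := cot_finite J
  have hlow := cot_lower hdec x y hm hk J e he hlen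
  have hsym := sym_socle hdec x y hm J e he
  set S := LinearMap.ker (LinearMap.id - (TensorProduct.comm k (O ⧸ J) (O ⧸ J)).toLinearMap)
    with hS
  set T := LinearMap.ker (dK k (O ⧸ J) (O ⧸ J) x) ⊓ LinearMap.ker (dK k (O ⧸ J) (O ⧸ J) y)
    with hT
  rw [inf_assoc, ← hT] at hsym
  have hST := Submodule.finrank_mono (inf_le_right : S ⊓ T ≤ T)
  refine ⟨by omega, fun heq => ?_, ?_⟩
  · have hTS : S ⊓ T = T := Submodule.eq_of_le_of_finrank_le inf_le_right (by omega)
    obtain ⟨g1, g2, hg⟩ := ci_of_socle hdec x y hm J hJm (by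
      refine aux_sym_line _ fun s hs t ht => ?_
      have hs1 : x • s = 0 := hs.1
      have hs2 : y • s = 0 := hs.2
      have ht1 : x • t = 0 := ht.1
      have ht2 : y • t = 0 := ht.2
      have hmem : s ⊗ₜ[k] t ∈ T := by
        refine ⟨?_, ?_⟩
        · change (x • s) ⊗ₜ[k] t - s ⊗ₜ[k] (x • t) = 0
          rw [hs1, ht1, TensorProduct.zero_tmul, TensorProduct.tmul_zero, sub_zero]
        · change (y • s) ⊗ₜ[k] t - s ⊗ₜ[k] (y • t) = 0
          rw [hs2, ht2, TensorProduct.zero_tmul, TensorProduct.tmul_zero, sub_zero]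
      rw [← hTS] at hmem
      have h1 : s ⊗ₜ[k] t - t ⊗ₜ[k] s = 0 := hmem.1
      exact sub_eq_zero.mp h1)
    rw [hg]
    exact aux_isRegular hdim x y hm g1 g2 e (hg ▸ he) (hg ▸ hJm)
  · rintro ⟨a, b, hJ, -⟩
    have := cot_upper (k := k) a b J hJ
    omega

end
end

section
/- Let k be a field, R = k[s,u,t,v] with the bigrading deg s = deg u = (1,0), deg t = deg v = (0,1), and let f1, f2, f3 ∈ R be bihomogeneous generating an ideal I = ⟨f1,f2,f3⟩ of height 2 such that no minimal prime over I contains the irrelevant ideal b = ⟨st, sv, ut, uv⟩. Then K^sat = V if and only if I is a local complete intersection, i.e., for every minimal prime P over I the extended ideal I·R_P in the localization R_P is generated by an R_P-regular sequence of length two. -/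
/-!
STATEMENT 13: k field, R = k[s,u,t,v] bigraded; f1,f2,f3 bihomogeneous
generating an ideal I of height 2 such that no minimal prime over I contains
the irrelevant ideal b = ⟨st,sv,ut,uv⟩.  Then K^sat = V iff I is a local
complete intersection.

Variables: X 0 = s, X 1 = u, X 2 = t, X 3 = v.
-/

open MvPolynomial

noncomputable section

/-- bidegree weights: s,u ↦ (1,0); t,v ↦ (0,1). -/
def bw : Fin 4 → ℤ × ℤ := ![(1,0), (1,0), (0,1), (0,1)]

/-- `p` is bihomogeneous of bidegree `(a,b)`. -/
def Bihom {k : Type} [Field k] (p : MvPolynomial (Fin 4) k) (a b : ℤ) : Prop :=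
  p.IsWeightedHomogeneous bw (a, b)

/-- The irrelevant ideal ⟨st, sv, ut, uv⟩. -/
def irrel (k : Type) [Field k] : Ideal (MvPolynomial (Fin 4) k) :=
  Ideal.span {X 0 * X 2, X 0 * X 3, X 1 * X 2, X 1 * X 3}

/-- Saturation of an ideal `I` with respect to the ideal `b`. -/
def Ideal.sat {A : Type*} [CommRing A] (b I : Ideal A) : Set A :=
  { x | ∃ j : ℕ, ∀ y ∈ b ^ j, y * x ∈ I }

/-- The Koszul module of f₁, f₂, f₃. -/
def Kos {k : Type} [Field k] (f₁ f₂ f₃ : MvPolynomial (Fin 4) k) :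
    Submodule (MvPolynomial (Fin 4) k) (Fin 3 → MvPolynomial (Fin 4) k) :=
  Submodule.span (MvPolynomial (Fin 4) k) {![f₂, -f₁, 0], ![f₃, 0, -f₁], ![0, f₃, -f₂]}

/-- Saturation of a submodule `M` with respect to an ideal `b`. -/
def Submodule.satSet {A : Type*} [CommRing A] (b : Ideal A) {N : Type*} [AddCommGroup N]
    [Module A N] (M : Submodule A N) : Set N :=
  { x | ∃ j : ℕ, ∀ y ∈ b ^ j, y • x ∈ M }

namespace KV

variable {L : Type*} [CommRing L]

def Syz (f h : Fin 3 → L) : Prop := h 0 * f 0 + h 1 * f 1 + h 2 * f 2 = 0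

def KM (f g : Fin 3 → L) : Prop := ∃ n : Fin 3 → L,
  g 0 = n 1 * f 2 - n 2 * f 1 ∧ g 1 = n 2 * f 0 - n 0 * f 2 ∧ g 2 = n 0 * f 1 - n 1 * f 0

def D2 (f : Fin 3 → L) : Prop := ∀ w : Fin 3 → L, (∀ i j, f i * w j = f j * w i) →
  ∃ c, ∀ i, w i = c * f i

theorem KM.syz {f g : Fin 3 → L} (h : KM f g) : Syz f g := by
  obtain ⟨n, h0, h1, h2⟩ := h
  unfold Syz; rw [h0, h1, h2]; ring

theorem KM.mem {f g : Fin 3 → L} (h : KM f g) {I : Ideal L} (hI : ∀ i, f i ∈ I) (i : Fin 3) :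
    g i ∈ I := by
  obtain ⟨n, h0, h1, h2⟩ := h
  fin_cases i
  · show g 0 ∈ I
    rw [h0]; exact I.sub_mem (I.mul_mem_left _ (hI _)) (I.mul_mem_left _ (hI _))
  · show g 1 ∈ I
    rw [h1]; exact I.sub_mem (I.mul_mem_left _ (hI _)) (I.mul_mem_left _ (hI _))
  · show g 2 ∈ I
    rw [h2]; exact I.sub_mem (I.mul_mem_left _ (hI _)) (I.mul_mem_left _ (hI _))

theorem KM.add {f g g' : Fin 3 → L} (h : KM f g) (h' : KM f g') : KM f (fun i => g i + g' i) := by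
  obtain ⟨n, h0, h1, h2⟩ := h
  obtain ⟨n', h0', h1', h2'⟩ := h'
  refine ⟨fun i => n i + n' i, ?_, ?_, ?_⟩
  · linear_combination h0 + h0'
  · linear_combination h1 + h1'
  · linear_combination h2 + h2'

theorem KM.smul {f g : Fin 3 → L} (h : KM f g) (r : L) : KM f (fun i => r * g i) := by
  obtain ⟨n, h0, h1, h2⟩ := h
  refine ⟨fun i => r * n i, ?_, ?_, ?_⟩
  · linear_combination r * h0
  · linear_combination r * h1
  · linear_combination r * h2

/-- `f j` kills first Koszul homology. -/
theorem Syz.f_mul {f h : Fin 3 → L} (hh : Syz f h) (j : Fin 3) : KM f (fun i => f j * h i) := by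
  unfold Syz at hh
  fin_cases j
  · refine ⟨![0, -h 2, h 1], ?_, ?_, ?_⟩ <;> simp <;> first | ring1 | linear_combination hh
  · refine ⟨![h 2, 0, -h 0], ?_, ?_, ?_⟩ <;> simp <;> first | ring1 | linear_combination hh
  · refine ⟨![-h 1, h 0, 0], ?_, ?_, ?_⟩ <;> simp <;> first | ring1 | linear_combination hh

theorem Syz.mem_mul {f h : Fin 3 → L} (hh : Syz f h) {x : L}
    (hx : x ∈ Ideal.span (Set.range f)) : KM f (fun i => x * h i) := by
  obtain ⟨c, rfl⟩ := (Submodule.mem_span_range_iff_exists_fun L).1 hx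
  have := ((((hh.f_mul 0).smul (c 0)).add ((hh.f_mul 1).smul (c 1)))).add ((hh.f_mul 2).smul (c 2))
  convert this using 2 with i
  simp [Fin.sum_univ_three]; ring

theorem cross_prop {f g h : Fin 3 → L} (hD : D2 f) (hg : Syz f g) (hh : Syz f h) :
    ∃ c, h 1 * g 2 - h 2 * g 1 = c * f 0 ∧ h 2 * g 0 - h 0 * g 2 = c * f 1 ∧
      h 0 * g 1 - h 1 * g 0 = c * f 2 := by
  unfold Syz at hg hh
  obtain ⟨c, hc⟩ := hD ![h 1 * g 2 - h 2 * g 1, h 2 * g 0 - h 0 * g 2, h 0 * g 1 - h 1 * g 0] (by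
    intro i j
    fin_cases i <;> fin_cases j <;> simp
    · linear_combination h 2 * hg - g 2 * hh
    · linear_combination -h 1 * hg + g 1 * hh
    · linear_combination -h 2 * hg + g 2 * hh
    · linear_combination h 0 * hg - g 0 * hh
    · linear_combination h 1 * hg - g 1 * hh
    · linear_combination -h 0 * hg + g 0 * hh)
  exact ⟨c, hc 0, hc 1, hc 2⟩

/-- entries of a syzygy kill `V / K` -/
theorem entry_mul {f g h : Fin 3 → L} (hD : D2 f) (hg : Syz f g) (hh : Syz f h)
    (hgI : ∀ i, g i ∈ Ideal.span (Set.range f)) (i : Fin 3) : KM f (fun j => h i * g j) := by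
  obtain ⟨c, h0, h1, h2⟩ := cross_prop hD hg hh
  have hk := hh.mem_mul (hgI i)
  obtain ⟨n, k0, k1, k2⟩ := hk
  simp only at k0 k1 k2
  refine ⟨n - c • Pi.single i 1, ?_, ?_, ?_⟩ <;> fin_cases i <;> simp at * <;>
    first
    | linear_combination k0
    | linear_combination k1
    | linear_combination k2
    | linear_combination k0 + h0
    | linear_combination k0 - h0
    | linear_combination k0 + h1
    | linear_combination k0 - h1
    | linear_combination k0 + h2
    | linear_combination k0 - h2
    | linear_combination k1 + h0
    | linear_combination k1 - h0
    | linear_combination k1 + h1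
    | linear_combination k1 - h1
    | linear_combination k1 + h2
    | linear_combination k1 - h2
    | linear_combination k2 + h0
    | linear_combination k2 - h0
    | linear_combination k2 + h1
    | linear_combination k2 - h1

/-- two generators force a syzygy with a unit entry -/
theorem exists_unit_entry [IsLocalRing L] {f : Fin 3 → L} {x y : L}
    (hI : Ideal.span (Set.range f) = Ideal.span {x, y}) :
    ∃ h, Syz f h ∧ ∃ i, IsUnit (h i) := by
  have h1 : ∀ i, ∃ a b, a * x + b * y = f i := fun i => by
    have : f i ∈ Ideal.span {x, y} := hI ▸ Ideal.subset_span ⟨i, rfl⟩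
    exact Ideal.mem_span_pair.1 this
  choose a b hab using h1
  have hx : x ∈ Ideal.span (Set.range f) := hI ▸ Ideal.subset_span (by simp)
  have hy : y ∈ Ideal.span (Set.range f) := hI ▸ Ideal.subset_span (by simp)
  obtain ⟨c, hc⟩ := (Submodule.mem_span_range_iff_exists_fun L).1 hx
  obtain ⟨d, hd⟩ := (Submodule.mem_span_range_iff_exists_fun L).1 hy
  simp only [Fin.sum_univ_three, smul_eq_mul] at hc hd
  by_contra hcon
  push Not at hcon
  have key : ∀ i j, (Pi.single i 1 - fun j => a i * c j + b i * d j : Fin 3 → L) j ∈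
      IsLocalRing.maximalIdeal L := by
    intro i j
    refine hcon _ ?_ j
    have := hab i
    unfold Syz
    fin_cases i <;> simp at this ⊢ <;> linear_combination -this - a _ * hc - b _ * hd
  let π := IsLocalRing.residue L
  have k2 : ∀ i j, π ((Pi.single i 1 : Fin 3 → L) j) = π (a i) * π (c j) + π (b i) * π (d j) := by
    intro i j
    have := (IsLocalRing.residue_eq_zero_iff _).2 (key i j)
    simp only [Pi.sub_apply, map_sub, map_add, map_mul] at this
    exact sub_eq_zero.1 this
  have e00 := k2 0 0
  have e01 := k2 0 1
  have e02 := k2 0 2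
  have e10 := k2 1 0
  have e11 := k2 1 1
  have e12 := k2 1 2
  have e20 := k2 2 0
  have e21 := k2 2 1
  have e22 := k2 2 2
  simp at e00 e01 e02 e10 e11 e12 e20 e21 e22
  generalize π (a 0) = a0 at *
  generalize π (a 1) = a1 at *
  generalize π (a 2) = a2 at *
  generalize π (b 0) = b0 at *
  generalize π (b 1) = b1 at *
  generalize π (b 2) = b2 at *
  generalize π (c 0) = c0 at *
  generalize π (c 1) = c1 at *
  generalize π (c 2) = c2 at *
  generalize π (d 0) = d0 at *
  generalize π (d 1) = d1 at *
  generalize π (d 2) = d2 at *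
  have : (1 : IsLocalRing.ResidueField L) = 0 := by
    have hdet : (a0 * c0 + b0 * d0) * ((a1 * c1 + b1 * d1) * (a2 * c2 + b2 * d2)
        - (a1 * c2 + b1 * d2) * (a2 * c1 + b2 * d1))
      - (a0 * c1 + b0 * d1) * ((a1 * c0 + b1 * d0) * (a2 * c2 + b2 * d2)
        - (a1 * c2 + b1 * d2) * (a2 * c0 + b2 * d0))
      + (a0 * c2 + b0 * d2) * ((a1 * c0 + b1 * d0) * (a2 * c1 + b2 * d1)
        - (a1 * c1 + b1 * d1) * (a2 * c0 + b2 * d0)) = 0 := by ring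
    rw [← e00, ← e01, ← e02, ← e10, ← e11, ← e12, ← e20, ← e21, ← e22] at hdet
    simp at hdet
  exact one_ne_zero this

/-- a syzygy with a unit entry gives two generators -/
theorem two_gen {f h : Fin 3 → L} (hh : Syz f h) {i : Fin 3} (hu : IsUnit (h i)) :
    ∃ x y, Ideal.span (Set.range f) = Ideal.span {x, y} := by
  obtain ⟨u, hu⟩ := hu
  have hui : (↑u⁻¹ : L) * h i = 1 := by rw [← hu]; simp
  unfold Syz at hh
  have aux : ∀ x y, (∀ j, f j ∈ Ideal.span {x, y}) → x ∈ Set.range f → y ∈ Set.range f →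
      Ideal.span (Set.range f) = Ideal.span {x, y} := by
    intro x y h1 h2 h3
    apply le_antisymm
    · rw [Ideal.span_le]; rintro _ ⟨j, rfl⟩; exact h1 j
    · rw [Ideal.span_le]; rintro _ (rfl | rfl)
      · exact Ideal.subset_span h2
      · exact Ideal.subset_span h3
  fin_cases i <;> simp only [Fin.zero_eta, Fin.mk_one, Fin.reduceFinMk, Fin.isValue] at hui
  · refine ⟨f 1, f 2, aux _ _ ?_ ⟨1, rfl⟩ ⟨2, rfl⟩⟩
    intro j
    rw [Ideal.mem_span_pair]
    fin_cases j
    · exact ⟨-↑u⁻¹ * h 1, -↑u⁻¹ * h 2, by simp only [Fin.zero_eta, Fin.isValue]; linear_combination -(↑u⁻¹ : L) * hh + f 0 * hui⟩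
    · exact ⟨1, 0, by simp⟩
    · exact ⟨0, 1, by simp⟩
  · refine ⟨f 0, f 2, aux _ _ ?_ ⟨0, rfl⟩ ⟨2, rfl⟩⟩
    intro j
    rw [Ideal.mem_span_pair]
    fin_cases j
    · exact ⟨1, 0, by simp⟩
    · exact ⟨-↑u⁻¹ * h 0, -↑u⁻¹ * h 2, by simp only [Fin.mk_one, Fin.isValue]; linear_combination -(↑u⁻¹ : L) * hh + f 1 * hui⟩
    · exact ⟨0, 1, by simp⟩
  · refine ⟨f 0, f 1, aux _ _ ?_ ⟨0, rfl⟩ ⟨1, rfl⟩⟩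
    intro j
    rw [Ideal.mem_span_pair]
    fin_cases j
    · exact ⟨1, 0, by simp⟩
    · exact ⟨0, 1, by simp⟩
    · exact ⟨-↑u⁻¹ * h 0, -↑u⁻¹ * h 1, by simp only [Fin.reduceFinMk, Fin.isValue]; linear_combination -(↑u⁻¹ : L) * hh + f 2 * hui⟩

/-- two generators of an ideal of depth two form a regular sequence -/
theorem regular_of_two_gen [IsDomain L] {f : Fin 3 → L} (hD : D2 f) {x y : L}
    (hI : Ideal.span (Set.range f) = Ideal.span {x, y})
    (hne : Ideal.span (Set.range f) ≠ ⊤) :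
    RingTheory.Sequence.IsRegular L [x, y] := by
  have h1 : ∀ i, ∃ a b, a * x + b * y = f i := fun i => by
    have : f i ∈ Ideal.span {x, y} := hI ▸ Ideal.subset_span ⟨i, rfl⟩
    exact Ideal.mem_span_pair.1 this
  choose a b hab using h1
  have hf : ∃ i, f i ≠ 0 := by
    by_contra hc
    push Not at hc
    obtain ⟨c, hc'⟩ := hD (fun _ => 1) (by intro i j; rw [hc i, hc j])
    have := hc' 0
    rw [hc 0] at this
    simp at this
  obtain ⟨i, hi⟩ := hf
  have hx : x ∈ Ideal.span (Set.range f) := hI ▸ Ideal.subset_span (by simp)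
  have hy : y ∈ Ideal.span (Set.range f) := hI ▸ Ideal.subset_span (by simp)
  have pair : ∀ α β, x * β = y * α → ∃ c, α = c * x ∧ β = c * y := by
    intro α β h
    obtain ⟨c, hc⟩ := hD (fun i => a i * α + b i * β) (by
      intro i j
      linear_combination (-(a j * α + b j * β)) * hab i + (a i * α + b i * β) * hab j + (a i * b j - a j * b i) * h)
    refine ⟨c, ?_, ?_⟩
    · apply mul_right_cancel₀ hi
      have := hc i
      linear_combination x * this - α * hab i - b i * h
    · apply mul_right_cancel₀ hi
      have := hc i
      linear_combination y * this - β * hab i + a i * h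
  have hyu : ¬ IsUnit y := fun h => hne (Ideal.eq_top_of_isUnit_mem _ hy h)
  have hx0 : x ≠ 0 := by
    rintro rfl
    obtain ⟨c, -, hc⟩ := pair 0 1 (by simp)
    exact hyu (IsUnit.of_mul_eq_one_right c hc.symm)
  refine ⟨?_, ?_⟩
  · rw [RingTheory.Sequence.isWeaklyRegular_cons_iff]
    refine ⟨fun r s h => mul_left_cancel₀ hx0 h, ?_⟩
    rw [RingTheory.Sequence.isWeaklyRegular_cons_iff]
    refine ⟨?_, RingTheory.Sequence.IsWeaklyRegular.nil _ _⟩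
    rw [isSMulRegular_iff_right_eq_zero_of_smul]
    intro z
    obtain ⟨β, rfl⟩ := Submodule.mkQ_surjective _ z
    intro h
    rw [← map_smul, Submodule.mkQ_apply, Submodule.Quotient.mk_eq_zero,
      Submodule.mem_smul_pointwise_iff_exists] at h
    obtain ⟨α, -, hα⟩ := h
    obtain ⟨c, -, hc⟩ := pair β α (by simpa using hα)
    rw [Submodule.mkQ_apply, Submodule.Quotient.mk_eq_zero,
      Submodule.mem_smul_pointwise_iff_exists]
    obtain ⟨c, hc, -⟩ := pair β α (by simpa using hα)
    exact ⟨c, trivial, by rw [hc]; simp [mul_comm]⟩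
  · intro h
    apply hne
    rw [hI]
    have : Ideal.ofList [x, y] = Ideal.span {x, y} := by
      simp [Ideal.ofList_cons, Ideal.span_insert]
    rw [this] at h
    rw [eq_comm]; simpa using h

end KV

namespace KV
open IsLocalRing
open scoped Pointwise

variable {L : Type*} [CommRing L]

/-- A noetherian local ring with principal non-nilpotent maximal ideal is a PID domain. -/
theorem isDomain_of_principal {A : Type*} [CommRing A] [IsLocalRing A] [IsNoetherianRing A]
    (b : A) (hb : maximalIdeal A = Ideal.span {b}) (hn : ¬ IsNilpotent b) :
    IsDomain A := by
  have key : ∀ x : A, x ≠ 0 → ∃ n u, IsUnit u ∧ x = u * b ^ n := by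
    intro x hx
    have h1 : ∃ n, x ∉ (maximalIdeal A) ^ n := by
      by_contra hc
      push Not at hc
      apply hx
      have := Ideal.iInf_pow_eq_bot_of_isLocalRing (maximalIdeal A) (Ideal.IsPrime.ne_top inferInstance)
      rw [← Ideal.mem_bot, ← this]
      exact Ideal.mem_iInf.2 hc
    classical
    obtain ⟨m, hm⟩ : ∃ m, Nat.find h1 = m + 1 := by
      refine Nat.exists_eq_succ_of_ne_zero ?_
      intro h
      have := Nat.find_spec h1
      rw [h] at this; simp at this
    have h2 := Nat.find_spec h1
    have h3 := Nat.find_min h1 (m := m) (by omega)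
    rw [hm] at h2
    push Not at h3
    rw [hb, Ideal.span_singleton_pow, Ideal.mem_span_singleton] at h2 h3
    obtain ⟨u, hu⟩ := h3
    refine ⟨m, u, ?_, by rw [hu]; ring⟩
    by_contra hnu
    have : u ∈ maximalIdeal A := hnu
    rw [hb, Ideal.mem_span_singleton] at this
    obtain ⟨v, rfl⟩ := this
    exact h2 ⟨v, by rw [hu]; ring⟩
  have : NoZeroDivisors A := by
    refine ⟨fun {x y} h => ?_⟩
    by_contra hc
    push Not at hc
    obtain ⟨n, u, hu, rfl⟩ := key x hc.1
    obtain ⟨m, v, hv, rfl⟩ := key y hc.2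
    apply hn
    refine ⟨n + m, ?_⟩
    apply (hu.mul hv).mul_left_cancel
    rw [mul_zero, ← h]; ring
  exact NoZeroDivisors.to_isDomain A

open Fintype in
theorem free_ker [IsDomain L] [IsLocalRing L] [IsNoetherianRing L] (a b : L)
    (hm : maximalIdeal L = Ideal.span {a, b}) (hdim : 2 ≤ (maximalIdeal L).height)
    (f : Fin 3 → L) : Module.Free L (LinearMap.ker (Fintype.linearCombination L f)) := by
  set S := LinearMap.ker (Fintype.linearCombination L f)
  have ham : a ∈ maximalIdeal L := hm ▸ Ideal.subset_span (by simp)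
  have hbm : b ∈ maximalIdeal L := hm ▸ Ideal.subset_span (by simp)
  have ha0 : a ≠ 0 := by
    rintro rfl
    have h1 : maximalIdeal L = Ideal.span {b} := by rw [hm, Ideal.span_insert]; simp
    have := Ideal.height_span_singleton_le_one (x := b) hbm
    rw [← h1] at this
    exact absurd (hdim.trans this) (by norm_num)
  let A := L ⧸ Ideal.span {a}
  have hAt : Ideal.span {a} ≠ (⊤ : Ideal L) := by
    rw [Ne, Ideal.span_singleton_eq_top]; exact ham
  have : Nontrivial A := Ideal.Quotient.nontrivial_iff.2 hAt
  have : IsLocalRing A := IsLocalRing.of_surjective' (Ideal.Quotient.mk _) Ideal.Quotient.mk_surjective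
  have hmA : maximalIdeal A = Ideal.span {Ideal.Quotient.mk _ b} := by
    have h1 : maximalIdeal A = (maximalIdeal L).map (Ideal.Quotient.mk (Ideal.span {a})) := by
      exact (IsLocalRing.map_maximalIdeal_of_surjective _ Ideal.Quotient.mk_surjective).symm
    rw [h1, hm, Ideal.map_span, Set.image_pair, Ideal.span_insert]
    simp
  have hnil : ¬ IsNilpotent (Ideal.Quotient.mk (Ideal.span {a}) b) := by
    rintro ⟨n, hn⟩
    rw [← map_pow, Ideal.Quotient.eq_zero_iff_mem] at hn
    have hmin : maximalIdeal L ∈ (Ideal.span {a}).minimalPrimes := by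
      refine ⟨⟨inferInstance, by rw [Ideal.span_le]; simpa using ham⟩, ?_⟩
      rintro Q ⟨hQ, haQ⟩ -
      rw [hm, Ideal.span_le]
      rintro _ (rfl | rfl)
      · exact haQ (Ideal.mem_span_singleton_self _)
      · exact hQ.mem_of_pow_mem _ (haQ hn)
    have := Ideal.height_le_one_of_isPrincipal_of_mem_minimalPrimes _ _ hmin
    exact absurd (hdim.trans this) (by norm_num)
  have : IsDomain A := isDomain_of_principal _ hmA hnil
  have hprime : (Ideal.span {a} : Ideal L).IsPrime := (Ideal.Quotient.isDomain_iff_prime _).1 this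
  have hpa : Prime a := (Ideal.span_singleton_prime ha0).1 hprime
  have : IsPrincipalIdealRing A := by
    have h2 : Submodule.IsPrincipal (maximalIdeal A) := ⟨⟨_, hmA⟩⟩
    exact ((tfae_of_isNoetherianRing_of_isLocalRing_of_isDomain A).out 0 4).2 h2
  have hreg : IsSMulRegular S a := by
    intro x y h
    apply Subtype.ext; funext i
    have := congrFun (congrArg Subtype.val h) i
    exact mul_left_cancel₀ ha0 this
  have : Module.FinitePresentation L S := Module.finitePresentation_of_finite L S
  refine (Module.free_quotSMulTop_iff_free L S (x := a) ?_ hreg).1 ?_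
  · rw [IsLocalRing.jacobson_eq_maximalIdeal _ bot_ne_top]; exact ham
  · have : Module.Finite A (QuotSMulTop a S) :=
      Module.Finite.of_restrictScalars_finite L A _
    have : Module.IsTorsionFree A (QuotSMulTop a S) := by
      rw [Module.isTorsionFree_iff_smul_eq_zero]
      intro r m
      obtain ⟨r, rfl⟩ := Ideal.Quotient.mk_surjective r
      obtain ⟨m, rfl⟩ := Submodule.mkQ_surjective _ m
      intro h
      by_cases har : a ∣ r
      · left; rwa [Ideal.Quotient.eq_zero_iff_mem, Ideal.mem_span_singleton]
      right
      have h' : r • (Submodule.mkQ (a • (⊤ : Submodule L S)) m) = 0 := h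
      rw [← map_smul, Submodule.mkQ_apply, Submodule.Quotient.mk_eq_zero,
        Submodule.mem_smul_pointwise_iff_exists] at h'
      obtain ⟨s, -, hs⟩ := h'
      have hdiv : ∀ i, a ∣ m.1 i := by
        intro i
        have := congrFun (congrArg Subtype.val hs) i
        have h3 : a ∣ r * m.1 i := ⟨s.1 i, this.symm⟩
        exact (hpa.dvd_or_dvd h3).resolve_left har
      choose t ht using hdiv
      have hmt : m.1 = a • t := funext ht
      have htS : t ∈ S := by
        have := m.2
        rw [LinearMap.mem_ker, hmt, map_smul, smul_eq_mul] at this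
        exact (mul_eq_zero.1 this).resolve_left ha0
      rw [Submodule.mkQ_apply, Submodule.Quotient.mk_eq_zero,
        Submodule.mem_smul_pointwise_iff_exists]
      exact ⟨⟨t, htS⟩, trivial, Subtype.ext hmt.symm⟩
    exact Module.free_of_finite_type_torsion_free'

theorem exists_basis [IsDomain L] [IsLocalRing L] [IsNoetherianRing L] (a b : L)
    (hm : maximalIdeal L = Ideal.span {a, b}) (hdim : 2 ≤ (maximalIdeal L).height)
    (f : Fin 3 → L) (hf : ∃ i, f i ≠ 0) :
    ∃ p q : Fin 3 → L, Syz f p ∧ Syz f q ∧ (∀ h, Syz f h → ∃ α β : L, h = α • p + β • q) ∧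
      ∀ α β : L, α • p + β • q = 0 → α = 0 ∧ β = 0 := by
  have hfree := free_ker a b hm hdim f
  set φ := Fintype.linearCombination L f with hφ
  have hsyz : ∀ h, h ∈ LinearMap.ker φ ↔ Syz f h := by
    intro h
    rw [LinearMap.mem_ker, hφ, Fintype.linearCombination_apply, Fin.sum_univ_three]
    rfl
  have hr := Submodule.finrank_quotient_add_finrank (LinearMap.ker φ)
  rw [φ.quotKerEquivRange.finrank_eq, Module.finrank_fin_fun] at hr
  have h1 : Module.finrank L (LinearMap.range φ) ≤ 1 := by
    have := Submodule.finrank_le (LinearMap.range φ)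
    rwa [Module.finrank_self] at this
  have h2 : 0 < Module.finrank L (LinearMap.range φ) := by
    rw [Module.finrank_pos_iff_exists_ne_zero]
    obtain ⟨i, hi⟩ := hf
    refine ⟨⟨f i, ⟨Pi.single i 1, ?_⟩⟩, fun h => hi (congrArg Subtype.val h)⟩
    rw [hφ, Fintype.linearCombination_apply_single]; simp
  have h3 : Module.finrank L (LinearMap.ker φ) = 2 := by omega
  let B := Module.finBasisOfFinrankEq L (LinearMap.ker φ) h3
  refine ⟨(B 0).1, (B 1).1, (hsyz _).1 (B 0).2, (hsyz _).1 (B 1).2, ?_, ?_⟩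
  · intro h hh
    refine ⟨B.repr ⟨h, (hsyz h).2 hh⟩ 0, B.repr ⟨h, (hsyz h).2 hh⟩ 1, ?_⟩
    have := B.sum_repr ⟨h, (hsyz h).2 hh⟩
    rw [Fin.sum_univ_two] at this
    exact (congrArg Subtype.val this).symm
  · intro α β h
    have h4 : ∑ i, (![α, β] : Fin 2 → L) i • B i = 0 := by
      rw [Fin.sum_univ_two]; exact Subtype.ext h
    have := Fintype.linearIndependent_iff.1 B.linearIndependent _ h4
    exact ⟨this 0, this 1⟩

/-- The key local statement: `V = K` forces a redundant generator. -/
theorem local_key [IsDomain L] [IsLocalRing L] [IsNoetherianRing L] (a b : L)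
    (hm : maximalIdeal L = Ideal.span {a, b}) (hdim : 2 ≤ (maximalIdeal L).height)
    (f : Fin 3 → L) (hf : ∃ i, f i ≠ 0) (hD : D2 f) (σ : L)
    (hσ : σ ∉ Ideal.span (Set.range f))
    (hσm : ∀ x ∈ maximalIdeal L, x * σ ∈ Ideal.span (Set.range f))
    (hVK : ∀ g, Syz f g → (∀ i, g i ∈ Ideal.span (Set.range f)) → KM f g) :
    ∃ h, Syz f h ∧ ∃ i, IsUnit (h i) := by
  by_contra hcon
  push Not at hcon
  obtain ⟨p, q, hp, hq, hgen, hind⟩ := exists_basis a b hm hdim f hf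
  have hK : ∀ h, Syz f h → KM f (fun i => h i * σ) := by
    intro h hh
    apply hVK
    · unfold Syz at *; linear_combination σ * hh
    · intro i; exact hσm _ (hcon h hh i)
  obtain ⟨N1, hN10, hN11, hN12⟩ := hK p hp
  obtain ⟨N2, hN20, hN21, hN22⟩ := hK q hq
  obtain ⟨c, hc0, hc1, hc2⟩ := cross_prop hD hq hp
  have hc : IsUnit c := by
    have hk : ∀ j : Fin 3, ∃ β, p j = c * β := by
      obtain ⟨i, hi⟩ := hf
      intro j
      have : ∃ k : Fin 3 → L, Syz f k ∧ p 1 * k 2 - p 2 * k 1 = -p j * f 0 ∧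
          p 2 * k 0 - p 0 * k 2 = - p j * f 1 ∧ p 0 * k 1 - p 1 * k 0 = -p j * f 2 := by
        unfold Syz at *
        fin_cases j <;> simp
        · exact ⟨![0, -f 2, f 1], by simp; ring, by simp; linear_combination hp, by simp, by simp⟩
        · exact ⟨![f 2, 0, -f 0], by simp; ring, by simp, by simp; linear_combination hp, by simp⟩
        · exact ⟨![-f 1, f 0, 0], by simp; ring, by simp, by simp, by simp; linear_combination hp⟩
      obtain ⟨k, hk, k0, k1, k2⟩ := this
      obtain ⟨α, β, rfl⟩ := hgen k hk
      refine ⟨-β, ?_⟩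
      apply mul_right_cancel₀ hi
      simp at k0 k1 k2
      fin_cases i <;> simp
      · linear_combination k0 - β * hc0
      · linear_combination k1 - β * hc1
      · linear_combination k2 - β * hc2
    choose β hβ using hk
    have hpβ : p = c • β := funext hβ
    have hc0 : c ≠ 0 := by
      rintro rfl
      have := (hind 1 0 (by rw [hpβ]; simp)).1
      exact one_ne_zero this
    have hβs : Syz f β := by
      apply mul_left_cancel₀ hc0
      unfold Syz at hp
      rw [hβ 0, hβ 1, hβ 2] at hp
      linear_combination hp
    obtain ⟨x, y, hxy⟩ := hgen β hβs
    have h5 := hind (c * x - 1) (c * y) (by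
      have : p = c • (x • p + y • q) := by rw [← hxy]; exact hpβ
      rw [sub_smul, one_smul, mul_smul, mul_smul]
      nth_rw 2 [this]
      rw [smul_add]; abel)
    exact IsUnit.of_mul_eq_one x (sub_eq_zero.1 h5.1)
  have d1 := hind (c * σ - (N1 0 * q 0 + N1 1 * q 1 + N1 2 * q 2))
    (N1 0 * p 0 + N1 1 * p 1 + N1 2 * p 2) (by
      funext i
      fin_cases i <;> simp
      · linear_combination c * hN10 - N1 1 * hc2 + N1 2 * hc1
      · linear_combination c * hN11 - N1 2 * hc0 + N1 0 * hc2
      · linear_combination c * hN12 - N1 0 * hc1 + N1 1 * hc0)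
  have d2 := hind (- (N2 0 * q 0 + N2 1 * q 1 + N2 2 * q 2))
    (c * σ + (N2 0 * p 0 + N2 1 * p 1 + N2 2 * p 2)) (by
      funext i
      fin_cases i <;> simp
      · linear_combination c * hN20 - N2 1 * hc2 + N2 2 * hc1
      · linear_combination c * hN21 - N2 2 * hc0 + N2 0 * hc2
      · linear_combination c * hN22 - N2 0 * hc1 + N2 1 * hc0)
  obtain ⟨d11, d12⟩ := d1
  obtain ⟨d21, d22⟩ := d2
  -- T (e) = -(N2·e) p + (N1·e) q
  have hT : ∀ l i j, f i * (c * σ * (Pi.single j 1 : Fin 3 → L) l - (-N2 j * p l + N1 j * q l)) =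
      f j * (c * σ * (Pi.single i 1 : Fin 3 → L) l - (-N2 i * p l + N1 i * q l)) := by
    intro l i j
    have hs : Syz f (f i • Pi.single j 1 - f j • Pi.single i 1) := by
      unfold Syz
      fin_cases i <;> fin_cases j <;> simp <;> ring
    obtain ⟨α, β, hαβ⟩ := hgen _ hs
    have hE : ∀ m : Fin 3, f i * (Pi.single j 1 : Fin 3 → L) m
        - f j * (Pi.single i 1 : Fin 3 → L) m = α * p m + β * q m := by
      intro m; simpa using congrFun hαβ m
    have hNf : ∀ N : Fin 3 → L, f i * N j - f j * N i =
        α * (N 0 * p 0 + N 1 * p 1 + N 2 * p 2) + β * (N 0 * q 0 + N 1 * q 1 + N 2 * q 2) := by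
      intro N
      have e0 := hE 0
      have e1 := hE 1
      have e2 := hE 2
      have : f i * N j - f j * N i =
        N 0 * (f i * (Pi.single j 1 : Fin 3 → L) 0 - f j * (Pi.single i 1 : Fin 3 → L) 0)
        + N 1 * (f i * (Pi.single j 1 : Fin 3 → L) 1 - f j * (Pi.single i 1 : Fin 3 → L) 1)
        + N 2 * (f i * (Pi.single j 1 : Fin 3 → L) 2 - f j * (Pi.single i 1 : Fin 3 → L) 2) := by
        fin_cases i <;> fin_cases j <;> simp <;> ring
      rw [this, e0, e1, e2]; ring
    linear_combination c * σ * hE l + p l * hNf N2 - q l * hNf N1 - p l * β * d21 + p l * α * d22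
      - q l * α * d12 + q l * β * d11
  choose w hw using fun l => hD (fun j => c * σ * (Pi.single j 1 : Fin 3 → L) l - (-N2 j * p l + N1 j * q l)) (hT l)
  have hfin : c * σ = w 0 * f 0 + w 1 * f 1 + w 2 * f 2 := by
    obtain ⟨i, hi⟩ := hf
    apply mul_right_cancel₀ hi
    have w0 := hw 0 i
    have w1 := hw 1 i
    have w2 := hw 2 i
    unfold Syz at hp hq
    have : f i = (Pi.single i 1 : Fin 3 → L) 0 * f 0 + (Pi.single i 1 : Fin 3 → L) 1 * f 1
      + (Pi.single i 1 : Fin 3 → L) 2 * f 2 := by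
      fin_cases i <;> simp
    linear_combination c * σ * this + f 0 * w0 + f 1 * w1 + f 2 * w2 - N2 i * hp + N1 i * hq
  apply hσ
  have hmem : c * σ ∈ Ideal.span (Set.range f) := by
    rw [hfin]
    refine Ideal.add_mem _ (Ideal.add_mem _ ?_ ?_) ?_ <;>
      exact Ideal.mul_mem_left _ _ (Ideal.subset_span ⟨_, rfl⟩)
  exact (Ideal.unit_mul_mem_iff_mem _ hc).1 hmem

end KV

namespace KV
open MvPolynomial

variable {k : Type} [Field k]

theorem mem_Kos_iff (f₁ f₂ f₃ : MvPolynomial (Fin 4) k) (g : Fin 3 → MvPolynomial (Fin 4) k) :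
    g ∈ Kos f₁ f₂ f₃ ↔ KM ![f₁, f₂, f₃] g := by
  unfold Kos
  rw [Submodule.mem_span_triple]
  constructor
  · rintro ⟨a, b, c, rfl⟩
    refine ⟨![-c, b, -a], ?_, ?_, ?_⟩ <;> simp <;> ring
  · rintro ⟨n, h0, h1, h2⟩
    refine ⟨-n 2, n 1, -n 0, ?_⟩
    funext i
    fin_cases i
    · simp at *; rw [h0]; ring
    · simp at *; rw [h1]; ring
    · simp at *; rw [h2]; ring

theorem range_vec (f₁ f₂ f₃ : MvPolynomial (Fin 4) k) :
    Set.range ![f₁, f₂, f₃] = {f₁, f₂, f₃} := by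
  ext x; simp [Matrix.range_cons]; tauto

theorem two_le_height {A : Type*} [CommRing A] {I : Ideal A} (h : idealHeight I = 2)
    (P : Ideal A) [hP : P.IsPrime] (hIP : I ≤ P) : 2 ≤ P.height := by
  have h1 : idealHeight I ≤ Order.height (⟨P, hP⟩ : PrimeSpectrum A) :=
    iInf₂_le (⟨P, hP⟩ : PrimeSpectrum A) hIP
  rw [h, ← PrimeSpectrum.height_eq_orderHeight] at h1
  exact h1

theorem D2_of_height {A : Type*} [CommRing A] [IsDomain A] [IsNoetherianRing A]
    [UniqueFactorizationMonoid A]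
    (f : Fin 3 → A)
    (hh : ∀ P : Ideal A, P.IsPrime → Ideal.span (Set.range f) ≤ P → 2 ≤ P.height) : D2 f := by
  intro w hw
  have hf : ∃ i, f i ≠ 0 := by
    by_contra hc
    push Not at hc
    have h1 := hh ⊥ Ideal.isPrime_bot (by
      rw [Ideal.span_le]; rintro _ ⟨i, rfl⟩; simp [hc i])
    rw [Ideal.height_bot] at h1
    simp at h1
  obtain ⟨i, hi⟩ := hf
  obtain ⟨a', b', c, hrel, ha, hb⟩ :=
    UniqueFactorizationMonoid.exists_reduced_factors (f i) hi (w i)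
  have hc : c ≠ 0 := by rintro rfl; apply hi; rw [← ha]; simp
  have key : ∀ j, a' * w j = b' * f j := by
    intro j
    apply mul_left_cancel₀ hc
    have := hw i j
    rw [← ha, ← hb] at this
    linear_combination this
  have hdvd : ∀ j, a' ∣ f j := fun j => hrel.dvd_of_dvd_mul_left ⟨w j, (key j).symm⟩
  have ha0 : a' ≠ 0 := by rintro rfl; apply hi; rw [← ha]; simp
  have hu : IsUnit a' := by
    by_contra hnu
    obtain ⟨π, hπ, hd⟩ := WfDvdMonoid.exists_irreducible_factor hnu ha0
    have hpr := hπ.prime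
    have hP : (Ideal.span {π} : Ideal A).IsPrime := (Ideal.span_singleton_prime hpr.ne_zero).2 hpr
    have h1 := hh _ hP (by
      rw [Ideal.span_le]; rintro _ ⟨j, rfl⟩
      exact Ideal.mem_span_singleton.2 (hd.trans (hdvd j)))
    have h2 := Ideal.height_le_one_of_isPrincipal_of_mem_minimalPrimes (Ideal.span {π})
      (Ideal.span {π}) (by rw [Ideal.minimalPrimes_eq_subsingleton_self]; simp)
    exact absurd (h1.trans h2) (by norm_num)
  obtain ⟨u, rfl⟩ := hu
  refine ⟨↑u⁻¹ * b', fun j => ?_⟩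
  rw [mul_assoc, ← key j, ← mul_assoc]; simp

theorem irrel_pow_ne (j : ℕ) : ∃ y ∈ irrel k ^ j, y ≠ 0 :=
  ⟨(X 0 * X 2) ^ j, Ideal.pow_mem_pow (Ideal.subset_span (by simp)) _,
    pow_ne_zero _ (mul_ne_zero (X_ne_zero _) (X_ne_zero _))⟩

end KV

namespace KV
open MvPolynomial

variable {k : Type} [Field k]

section core
variable {M : Type} [AddCommGroup M] [LinearOrder M] [IsOrderedAddMonoid M] (w : Fin 4 → M)

/-- the largest `w`-homogeneous ideal inside `P` -/
def core (P : Ideal (MvPolynomial (Fin 4) k)) : Ideal (MvPolynomial (Fin 4) k) :=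
  letI := weightedGradedAlgebra k w
  (Ideal.homogeneousCore (weightedHomogeneousSubmodule k w) P).toIdeal

theorem core_le (P : Ideal (MvPolynomial (Fin 4) k)) : core w P ≤ P := by
  letI := weightedGradedAlgebra k w
  exact Ideal.toIdeal_homogeneousCore_le _ P

theorem core_isPrime (P : Ideal (MvPolynomial (Fin 4) k)) (hP : P.IsPrime) :
    (core w P).IsPrime := by
  letI := weightedGradedAlgebra k w
  exact hP.homogeneousCore (𝒜 := weightedHomogeneousSubmodule k w)

theorem mem_core_of_hom {P : Ideal (MvPolynomial (Fin 4) k)} {p : MvPolynomial (Fin 4) k} {d : M}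
    (hp : p.IsWeightedHomogeneous w d) (h : p ∈ P) : p ∈ core w P := by
  letI := weightedGradedAlgebra k w
  exact Ideal.mem_homogeneousCore_of_homogeneous_of_mem (𝒜 := weightedHomogeneousSubmodule k w)
    ⟨d, hp⟩ h

/-- component -/
def cmp (n : M) (p : MvPolynomial (Fin 4) k) : MvPolynomial (Fin 4) k :=
  letI := weightedGradedAlgebra k w
  (DirectSum.decompose (weightedHomogeneousSubmodule k w) p n : MvPolynomial (Fin 4) k)

theorem cmp_hom (n : M) (p : MvPolynomial (Fin 4) k) : (cmp w n p).IsWeightedHomogeneous w n := by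
  letI := weightedGradedAlgebra k w
  exact (DirectSum.decompose (weightedHomogeneousSubmodule k w) p n).2

theorem cmp_add (n : M) (p q : MvPolynomial (Fin 4) k) :
    cmp w n (p + q) = cmp w n p + cmp w n q := by
  letI := weightedGradedAlgebra k w
  unfold cmp
  rw [DirectSum.decompose_add]; rfl

theorem cmp_zero (n : M) : cmp w n (0 : MvPolynomial (Fin 4) k) = 0 := by
  letI := weightedGradedAlgebra k w
  unfold cmp
  rw [DirectSum.decompose_zero]; rfl

theorem cmp_mul (n d : M) (p q : MvPolynomial (Fin 4) k) (hq : q.IsWeightedHomogeneous w d) :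
    cmp w (n + d) (p * q) = cmp w n p * q := by
  letI := weightedGradedAlgebra k w
  exact DirectSum.coe_decompose_mul_add_of_right_mem _ hq

theorem mem_of_cmp {P : Ideal (MvPolynomial (Fin 4) k)} {p : MvPolynomial (Fin 4) k}
    (h : ∀ n, cmp w n p ∈ P) : p ∈ P := by
  letI := weightedGradedAlgebra k w
  classical
  rw [← DirectSum.sum_support_decompose (weightedHomogeneousSubmodule k w) p]
  exact Ideal.sum_mem _ fun n _ => h n

theorem mem_core_of_cmp {P : Ideal (MvPolynomial (Fin 4) k)} {p : MvPolynomial (Fin 4) k}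
    (h : ∀ n, cmp w n p ∈ P) : p ∈ core w P :=
  mem_of_cmp w fun n => mem_core_of_hom w (cmp_hom w n p) (h n)

theorem cmp_mem_core {P : Ideal (MvPolynomial (Fin 4) k)} {p : MvPolynomial (Fin 4) k}
    (h : p ∈ core w P) (n : M) : cmp w n p ∈ core w P := by
  letI := weightedGradedAlgebra k w
  exact (Ideal.homogeneousCore (weightedHomogeneousSubmodule k w) P).isHomogeneous n h

theorem cmp_of_hom {p : MvPolynomial (Fin 4) k} {d : M} (hp : p.IsWeightedHomogeneous w d) :
    cmp w d p = p := by
  letI := weightedGradedAlgebra k w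
  exact DirectSum.decompose_of_mem_same _ hp

theorem cmp_of_hom_ne {p : MvPolynomial (Fin 4) k} {d n : M} (hp : p.IsWeightedHomogeneous w d)
    (hn : d ≠ n) : cmp w n p = 0 := by
  letI := weightedGradedAlgebra k w
  exact DirectSum.decompose_of_mem_ne _ hp hn

/-- homogeneous syzygy lemma -/
theorem syz_core (f : Fin 3 → MvPolynomial (Fin 4) k) (d : Fin 3 → M)
    (hf : ∀ i, (f i).IsWeightedHomogeneous w (d i)) (P : Ideal (MvPolynomial (Fin 4) k))
    (hP : ∀ h, Syz f h → ∀ i, h i ∈ P) (h : Fin 3 → MvPolynomial (Fin 4) k) (hh : Syz f h)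
    (i : Fin 3) : h i ∈ core w P := by
  apply mem_core_of_cmp
  intro n
  have := hP (fun j => cmp w (n + d i - d j) (h j)) (by
    unfold Syz at *
    rw [← cmp_mul w _ _ _ _ (hf 0), ← cmp_mul w _ _ _ _ (hf 1), ← cmp_mul w _ _ _ _ (hf 2)]
    simp only [sub_add_cancel]
    rw [← cmp_add, ← cmp_add, hh, cmp_zero]) i
  simpa using this

end core

/-- lexicographic version of the bidegree weights -/
def bwl : Fin 4 → Lex (ℤ × ℤ) := fun i => toLex (bw i)

theorem bihom_iff {p : MvPolynomial (Fin 4) k} {a b : ℤ} :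
    Bihom p a b ↔ p.IsWeightedHomogeneous bwl (toLex (a, b)) := by
  rfl

end KV

namespace KV
open MvPolynomial

variable {k : Type} [Field k]

theorem X_sub_one_not_mem_core {M : Type} [AddCommGroup M] [LinearOrder M] [IsOrderedAddMonoid M]
    (w : Fin 4 → M) (P : Ideal (MvPolynomial (Fin 4) k)) (hP : P.IsPrime) (i : Fin 4)
    (hi : w i ≠ 0) : (X i - 1 : MvPolynomial (Fin 4) k) ∉ core w P := by
  intro h
  have h1 := cmp_mem_core w h 0
  have h2 : (-1 : MvPolynomial (Fin 4) k).IsWeightedHomogeneous w 0 := by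
    have := (weightedHomogeneousSubmodule k w 0).neg_mem (isWeightedHomogeneous_one k w)
    exact this
  rw [sub_eq_add_neg, cmp_add, cmp_of_hom_ne w (isWeightedHomogeneous_X k w i) hi,
    cmp_of_hom w h2, zero_add] at h1
  have h3 := Ideal.neg_mem_iff _ |>.1 h1
  exact (core_isPrime w P hP).ne_top ((Ideal.eq_top_iff_one _).2 h3)

theorem weight_bwl (m : Fin 4 →₀ ℕ) : Finsupp.weight bwl m =
    toLex ((m 0 : ℤ) + m 1, (m 2 : ℤ) + m 3) := by
  rw [Finsupp.weight_apply, Finsupp.sum_fintype _ _ (by simp), Fin.sum_univ_four]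
  apply ofLex.injective
  simp only [bwl, bw, ofLex_add, ofLex_smul, ofLex_toLex]
  ext <;> simp

/-- the dehomogenisation -/
def theta {κ : Type} [Field κ] (φ : MvPolynomial (Fin 4) k →+* κ) (s t : κ) :
    MvPolynomial (Fin 4) k →+* κ :=
  eval₂Hom (φ.comp C) (![φ (X 0) / s, φ (X 1) / s, φ (X 2) / t, φ (X 3) / t])

theorem theta_hom {κ : Type} [Field κ] (φ : MvPolynomial (Fin 4) k →+* κ) (s t : κ)
    (hs : s ≠ 0) (ht : t ≠ 0) {p : MvPolynomial (Fin 4) k} {a b : ℤ}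
    (hp : p.IsWeightedHomogeneous bwl (toLex (a, b))) :
    theta φ s t p * (s ^ a * t ^ b) = φ p := by
  have h1 : φ p = eval₂ (φ.comp C) (fun i => φ (X i)) p := by
    have : φ = eval₂Hom (φ.comp C) (fun i => φ (X i)) := by
      apply MvPolynomial.ringHom_ext <;> intro r <;> simp
    conv_lhs => rw [this]
    rfl
  rw [h1, theta, coe_eval₂Hom, eval₂_eq', eval₂_eq', Finset.sum_mul]
  refine Finset.sum_congr rfl fun m hm => ?_
  have h2 := hp (mem_support_iff.1 hm)
  rw [weight_bwl] at h2
  have h3 : ((m 0 : ℤ) + m 1, (m 2 : ℤ) + m 3) = (a, b) := toLex.injective h2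
  rw [Prod.mk.injEq] at h3
  obtain ⟨rfl, rfl⟩ := h3
  rw [Fin.prod_univ_four, Fin.prod_univ_four, zpow_add₀ hs, zpow_add₀ ht]
  simp [div_pow]
  field_simp

theorem height_core_le (P : Ideal (MvPolynomial (Fin 4) k)) (hP : P.IsPrime)
    (hirr : ¬ irrel k ≤ P) : (core bwl P).height ≤ 2 := by
  have hQ := core_isPrime bwl P hP
  set Q := core bwl P with hQdef
  obtain ⟨i0, j0, hi0, hj0, hX⟩ : ∃ i0 j0 : Fin 4, (i0 = 0 ∨ i0 = 1) ∧ (j0 = 2 ∨ j0 = 3) ∧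
      (X i0 * X j0 : MvPolynomial (Fin 4) k) ∉ Q := by
    by_contra hc
    push Not at hc
    apply hirr
    refine le_trans ?_ (core_le bwl P)
    unfold irrel
    rw [Ideal.span_le]
    rintro _ (rfl | rfl | rfl | rfl)
    · exact hc 0 2 (by simp) (by simp)
    · exact hc 0 3 (by simp) (by simp)
    · exact hc 1 2 (by simp) (by simp)
    · exact hc 1 3 (by simp) (by simp)
  let κ := FractionRing (MvPolynomial (Fin 4) k ⧸ Q)
  let φ : MvPolynomial (Fin 4) k →+* κ := (algebraMap _ κ).comp (Ideal.Quotient.mk Q)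
  have hφ : ∀ p, φ p = 0 ↔ p ∈ Q := by
    intro p
    rw [← Ideal.Quotient.eq_zero_iff_mem]
    exact map_eq_zero_iff (algebraMap (MvPolynomial (Fin 4) k ⧸ Q) κ) (IsFractionRing.injective _ κ)
  have hs : φ (X i0) ≠ 0 := fun h => hX (Q.mul_mem_right _ ((hφ _).1 h))
  have ht : φ (X j0) ≠ 0 := fun h => hX (Q.mul_mem_left _ ((hφ _).1 h))
  let θ := theta φ (φ (X i0)) (φ (X j0))
  have hθi : θ (X i0) = 1 := by
    rcases hi0 with rfl | rfl <;> simp [θ, theta, hs]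
  have hθj : θ (X j0) = 1 := by
    rcases hj0 with rfl | rfl <;> simp [θ, theta, ht]
  let M := RingHom.ker θ
  have hM : M.IsPrime := RingHom.ker_isPrime θ
  let w' : Fin 4 → ℤ := ![1, 1, 0, 0]
  let N := core w' M
  have hN : N.IsPrime := core_isPrime w' M hM
  have hQN : Q ≤ N := by
    intro q hq
    apply mem_of_cmp bwl
    intro n
    obtain ⟨⟨a, b⟩, rfl⟩ := toLex.surjective n
    have h1 := cmp_mem_core bwl hq (toLex (a, b))
    have h2 := cmp_hom bwl (toLex (a, b)) q
    have h3 := theta_hom φ _ _ hs ht h2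
    rw [(hφ _).2 h1] at h3
    have h4 : θ (cmp bwl (toLex (a, b)) q) = 0 :=
      (mul_eq_zero.1 h3).resolve_right (mul_ne_zero (zpow_ne_zero _ hs) (zpow_ne_zero _ ht))
    refine mem_core_of_hom w' (d := a) ?_ h4
    intro m hm
    have h5 := h2 hm
    rw [weight_bwl] at h5
    have h3 : ((m 0 : ℤ) + m 1, (m 2 : ℤ) + m 3) = (a, b) := toLex.injective h5
    rw [Prod.mk.injEq] at h3
    rw [Finsupp.weight_apply, Finsupp.sum_fintype _ _ (by simp), Fin.sum_univ_four, ← h3.1]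
    simp [w']
  have hjN : (X j0 - 1 : MvPolynomial (Fin 4) k) ∈ N := by
    refine mem_core_of_hom w' (d := 0) ?_ ?_
    · refine (weightedHomogeneousSubmodule k w' 0).sub_mem ?_ (isWeightedHomogeneous_one k w')
      have := isWeightedHomogeneous_X k w' j0
      rcases hj0 with rfl | rfl <;> exact this
    · rw [RingHom.mem_ker, map_sub, hθj, map_one, sub_self]
  have hiM : (X i0 - 1 : MvPolynomial (Fin 4) k) ∈ M := by
    rw [RingHom.mem_ker, map_sub, hθi, map_one, sub_self]
  have hjQ : (X j0 - 1 : MvPolynomial (Fin 4) k) ∉ Q := by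
    apply X_sub_one_not_mem_core bwl P hP
    rcases hj0 with rfl | rfl <;> decide
  have hiN : (X i0 - 1 : MvPolynomial (Fin 4) k) ∉ N := by
    apply X_sub_one_not_mem_core w' M hM
    rcases hi0 with rfl | rfl <;> simp [w']
  have lt1 : Q < N := lt_of_le_of_ne hQN fun h => hjQ (h ▸ hjN)
  have lt2 : N < M := lt_of_le_of_ne (core_le w' M) fun h => hiN (h ▸ hiM)
  have e1 := Ideal.height_add_one_le_of_lt_of_isPrime lt1
  have e2 := Ideal.height_add_one_le_of_lt_of_isPrime lt2
  have e3 := Ideal.height_le_ringKrullDim_of_isPrime (I := M)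
  rw [MvPolynomial.ringKrullDim_of_isNoetherianRing, ringKrullDim_eq_zero_of_field] at e3
  have e4 : M.height ≤ 4 := by
    have : ((M.height : ℕ∞) : WithBot ℕ∞) ≤ ((4 : ℕ∞) : WithBot ℕ∞) := by
      refine e3.trans ?_
      simp
    exact WithBot.coe_le_coe.1 this
  have e5 : Q.height + 2 ≤ 4 := by
    calc Q.height + 2 = (Q.height + 1) + 1 := by rw [add_assoc]; norm_num
      _ ≤ N.height + 1 := by gcongr
      _ ≤ M.height := e2
      _ ≤ 4 := e4
  have e6 : Q.height + 2 ≤ 2 + 2 := e5.trans (by norm_num)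
  exact (ENat.add_le_add_iff_right (by simp)).1 e6

end KV

namespace KV
open MvPolynomial

section loc
variable {A : Type*} [CommRing A] [IsDomain A] (P : Ideal A) [P.IsPrime]

theorem loc_inj : Function.Injective (algebraMap A (Localization.AtPrime P)) :=
  IsLocalization.injective _ P.primeCompl_le_nonZeroDivisors

theorem loc_unit {b : A} (hb : b ∉ P) : IsUnit (algebraMap A (Localization.AtPrime P) b) :=
  (IsLocalization.AtPrime.isUnit_to_map_iff _ P b).2 hb

theorem exists_num (h : Fin 3 → Localization.AtPrime P) :
    ∃ b, b ∉ P ∧ ∃ h' : Fin 3 → A, ∀ i, algebraMap A (Localization.AtPrime P) (h' i) =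
      algebraMap A (Localization.AtPrime P) b * h i := by
  obtain ⟨b, hb⟩ := IsLocalization.exist_integer_multiples_of_finite P.primeCompl h
  choose h' hh' using hb
  exact ⟨b, b.2, h', fun i => by rw [hh' i, Algebra.smul_def]⟩

theorem D2_loc {f : Fin 3 → A} (hD : D2 f) :
    D2 (fun i => algebraMap A (Localization.AtPrime P) (f i)) := by
  intro w hw
  obtain ⟨b, hb, w', hw'⟩ := exists_num P w
  obtain ⟨c, hc⟩ := hD w' (by
    intro i j
    apply loc_inj P
    rw [map_mul, map_mul, hw', hw']
    linear_combination algebraMap A (Localization.AtPrime P) b * hw i j)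
  obtain ⟨u, hu⟩ := loc_unit P hb
  refine ⟨↑u⁻¹ * algebraMap A _ c, fun i => ?_⟩
  have := hw' i
  rw [hc i, map_mul, ← hu] at this
  rw [mul_assoc, this, ← mul_assoc]; simp

theorem syz_num {f : Fin 3 → A} {h : Fin 3 → Localization.AtPrime P}
    (hh : Syz (fun i => algebraMap A (Localization.AtPrime P) (f i)) h) :
    ∃ b, b ∉ P ∧ ∃ h' : Fin 3 → A, Syz f h' ∧ ∀ i, algebraMap A (Localization.AtPrime P) (h' i) =
      algebraMap A (Localization.AtPrime P) b * h i := by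
  obtain ⟨b, hb, h', hh'⟩ := exists_num P h
  refine ⟨b, hb, h', ?_, hh'⟩
  unfold Syz at *
  apply loc_inj P
  simp only [map_add, map_mul, hh', map_zero]
  linear_combination algebraMap A (Localization.AtPrime P) b * hh

theorem map_span_range (f : Fin 3 → A) :
    (Ideal.span (Set.range f)).map (algebraMap A (Localization.AtPrime P)) =
      Ideal.span (Set.range fun i => algebraMap A (Localization.AtPrime P) (f i)) := by
  rw [Ideal.map_span, ← Set.range_comp]; rfl

theorem KM.map {B : Type*} [CommRing B] (φ : A →+* B) {f g : Fin 3 → A} (h : KM f g) :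
    KM (fun i => φ (f i)) (fun i => φ (g i)) := by
  obtain ⟨n, h0, h1, h2⟩ := h
  exact ⟨fun i => φ (n i), by simp [h0], by simp [h1], by simp [h2]⟩

theorem KM.zero {f : Fin 3 → A} : KM f (fun _ => 0) := ⟨fun _ => 0, by simp, by simp, by simp⟩

end loc

variable {k : Type} [Field k]

theorem core_min (f : Fin 3 → MvPolynomial (Fin 4) k) (d : Fin 3 → Lex (ℤ × ℤ))
    (hf : ∀ i, (f i).IsWeightedHomogeneous bwl (d i))
    (hh : ∀ P : Ideal (MvPolynomial (Fin 4) k), P.IsPrime →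
      Ideal.span (Set.range f) ≤ P → 2 ≤ P.height)
    (P : Ideal (MvPolynomial (Fin 4) k)) (hP : P.IsPrime) (hIP : Ideal.span (Set.range f) ≤ P)
    (hirr : ¬ irrel k ≤ P) : core bwl P ∈ (Ideal.span (Set.range f)).minimalPrimes := by
  refine ⟨⟨core_isPrime bwl P hP, ?_⟩, ?_⟩
  · rw [Ideal.span_le]
    rintro _ ⟨i, rfl⟩
    exact mem_core_of_hom bwl (hf i) (hIP (Ideal.subset_span ⟨i, rfl⟩))
  · rintro Q ⟨hQ, hIQ⟩ hle
    exact (Ideal.eq_of_le_of_height_le Q hle ((height_core_le P hP hirr).trans (hh Q hQ hIQ))).ge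

theorem exists_pow_not_mem {P : Ideal (MvPolynomial (Fin 4) k)} (hP : P.IsPrime)
    (hirr : ¬ irrel k ≤ P) (j : ℕ) : ∃ y ∈ irrel k ^ j, y ∉ P := by
  obtain ⟨x, hx, hxP⟩ := SetLike.not_le_iff_exists.1 hirr
  exact ⟨x ^ j, Ideal.pow_mem_pow hx j, fun h => hxP (hP.mem_of_pow_mem _ h)⟩

theorem backward (f : Fin 3 → MvPolynomial (Fin 4) k) (d : Fin 3 → Lex (ℤ × ℤ))
    (hf : ∀ i, (f i).IsWeightedHomogeneous bwl (d i))
    (hh : ∀ P : Ideal (MvPolynomial (Fin 4) k), P.IsPrime →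
      Ideal.span (Set.range f) ≤ P → 2 ≤ P.height)
    (hlci : ∀ P : Ideal (MvPolynomial (Fin 4) k), ∀ _ : P.IsPrime,
      P ∈ (Ideal.span (Set.range f)).minimalPrimes → ∃ x y : Localization.AtPrime P,
        (Ideal.span (Set.range f)).map
          (algebraMap (MvPolynomial (Fin 4) k) (Localization.AtPrime P)) = Ideal.span {x, y})
    (g : Fin 3 → MvPolynomial (Fin 4) k) (hg : Syz f g)
    (hgs : ∀ i, g i ∈ Ideal.sat (irrel k) (Ideal.span (Set.range f))) :
    ∃ j : ℕ, ∀ y ∈ irrel k ^ j, KM f (fun i => y * g i) := by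
  have hD : D2 f := D2_of_height f hh
  let J : Ideal (MvPolynomial (Fin 4) k) :=
    { carrier := {r | KM f (fun i => r * g i)}
      add_mem' := by
        intro a b ha hb
        rw [Set.mem_setOf_eq] at *
        have := KM.add ha hb
        simpa only [← add_mul] using this
      zero_mem' := by
        have := KM.zero (f := f)
        simpa using this
      smul_mem' := by
        intro c x hx
        rw [Set.mem_setOf_eq] at *
        have := KM.smul hx c
        simpa only [← mul_assoc, smul_eq_mul] using this }
  suffices h : irrel k ≤ J.radical by
    obtain ⟨n, hn⟩ := Ideal.exists_pow_le_of_le_radical_of_fg h (IsNoetherian.noetherian _)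
    exact ⟨n, fun y hy => hn hy⟩
  rw [Ideal.radical_eq_sInf]
  refine le_sInf ?_
  rintro P ⟨hJP, hP⟩
  by_contra hirr
  have key : ∃ r ∈ J, r ∉ P := by
    by_cases hIP : Ideal.span (Set.range f) ≤ P
    · have hmin := core_min f d hf hh P hP hIP hirr
      have hQ := core_isPrime bwl P hP
      obtain ⟨x, y, hxy⟩ := hlci _ hQ hmin
      rw [map_span_range] at hxy
      obtain ⟨h, hhs, i, hi⟩ := exists_unit_entry hxy
      obtain ⟨b, hb, h', hs', heq⟩ := syz_num _ hhs
      have hi' : h' i ∉ core bwl P := by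
        have : IsUnit (algebraMap _ (Localization.AtPrime (core bwl P)) (h' i)) := by
          rw [heq i]; exact (loc_unit _ hb).mul hi
        exact (IsLocalization.AtPrime.isUnit_to_map_iff _ (core bwl P) _).1 this
      obtain ⟨h2, hs2, i2, hi2⟩ : ∃ h, Syz f h ∧ ∃ i, h i ∉ P := by
        by_contra hc
        push Not at hc
        exact hi' (syz_core bwl f d hf P hc h' hs' i)
      choose j hj using hgs
      obtain ⟨y, hy, hyP⟩ := exists_pow_not_mem hP hirr (j 0 + j 1 + j 2)
      have hyI : ∀ i, y * g i ∈ Ideal.span (Set.range f) := by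
        intro i
        apply hj i
        refine Ideal.pow_le_pow_right ?_ hy
        fin_cases i <;> simp <;> omega
      have hyg : Syz f (fun i => y * g i) := by
        unfold Syz at *
        linear_combination y * hg
      refine ⟨h2 i2 * y, ?_, fun h => ?_⟩
      · have := entry_mul hD hyg hs2 hyI i2
        simp only [← mul_assoc] at this
        exact this
      · exact (hP.mem_or_mem h).elim hi2 hyP
    · obtain ⟨x, hx, hxP⟩ := SetLike.not_le_iff_exists.1 hIP
      exact ⟨x, hg.mem_mul hx, hxP⟩
  obtain ⟨r, hr, hrP⟩ := key
  exact hrP (hJP hr)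

open IsLocalRing in
theorem forward (f : Fin 3 → MvPolynomial (Fin 4) k)
    (hh : ∀ P : Ideal (MvPolynomial (Fin 4) k), P.IsPrime →
      Ideal.span (Set.range f) ≤ P → 2 ≤ P.height)
    (hV : ∀ g, Syz f g → (∀ i, g i ∈ Ideal.span (Set.range f)) →
      ∃ j : ℕ, ∀ y ∈ irrel k ^ j, KM f (fun i => y * g i))
    (P : Ideal (MvPolynomial (Fin 4) k)) (hP : P.IsPrime)
    (hmin : P ∈ (Ideal.span (Set.range f)).minimalPrimes)
    (hirr : ¬ irrel k ≤ P) (hP2 : P.height ≤ 2) :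
    ∃ x y : Localization.AtPrime P,
        (Ideal.span (Set.range f)).map
          (algebraMap (MvPolynomial (Fin 4) k) (Localization.AtPrime P)) = Ideal.span {x, y} ∧
        RingTheory.Sequence.IsRegular (Localization.AtPrime P) [x, y] := by
  have hD : D2 f := D2_of_height f hh
  have hIP := hmin.1.2
  have hht : P.height = 2 := le_antisymm hP2 (hh P hP hIP)
  set L := Localization.AtPrime P with hL
  set φ := algebraMap (MvPolynomial (Fin 4) k) L with hφ
  have hDL : D2 (fun i => φ (f i)) := D2_loc P hD
  have hmap : (Ideal.span (Set.range f)).map φ = Ideal.span (Set.range fun i => φ (f i)) :=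
    map_span_range P f
  have hdim : ringKrullDim L = ((2 : ℕ∞) : WithBot ℕ∞) := by
    rw [IsLocalization.AtPrime.ringKrullDim_eq_height P L, hht]
  have hmht : 2 ≤ (maximalIdeal L).height := by
    have := maximalIdeal_height_eq_ringKrullDim (R := L)
    rw [hdim] at this
    exact (WithBot.coe_injective this).ge
  obtain ⟨a, b, hab⟩ : ∃ a b, maximalIdeal L = Ideal.span {a, b} := by
    have hreg : IsRegularLocalRing L := IsRegularRing.isRegularLocalRing_localization P
    have h1 := hreg.spanFinrank_maximalIdeal
    rw [hdim] at h1
    have h2 : (maximalIdeal L).spanFinrank = 2 := by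
      have h3 : (((maximalIdeal L).spanFinrank : ℕ∞) : WithBot ℕ∞) = ((2 : ℕ∞) : WithBot ℕ∞) := h1
      exact_mod_cast WithBot.coe_injective h3
    have h3 := Submodule.FG.generators_ncard (p := maximalIdeal L) (IsNoetherian.noetherian _)
    rw [h2, Set.ncard_eq_two] at h3
    obtain ⟨a, b, -, h4⟩ := h3
    refine ⟨a, b, ?_⟩
    rw [← h4]; exact (Submodule.span_generators _).symm
  have hne : Ideal.span (Set.range fun i => φ (f i)) ≠ ⊤ := by
    have : Ideal.span (Set.range fun i => φ (f i)) ≤ maximalIdeal L := by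
      rw [← hmap, ← Localization.AtPrime.map_eq_maximalIdeal]
      exact Ideal.map_mono hIP
    intro h
    rw [h] at this
    exact (maximalIdeal.isMaximal L).ne_top (top_le_iff.1 this)
  have hrad : maximalIdeal L ≤ (Ideal.span (Set.range fun i => φ (f i))).radical := by
    rw [Ideal.radical_eq_sInf]
    refine le_sInf ?_
    rintro N ⟨hIN, hN⟩
    have h1 : Ideal.span (Set.range f) ≤ N.comap φ := by
      rw [← Ideal.map_le_iff_le_comap, hmap]; exact hIN
    have h2 : N.comap φ ≤ P := by
      intro x hx
      by_contra hxP
      exact hN.ne_top (Ideal.eq_top_of_isUnit_mem _ hx (loc_unit P hxP))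
    have h3 := hmin.2 ⟨Ideal.comap_isPrime φ N, h1⟩ h2
    rw [← Localization.AtPrime.map_eq_maximalIdeal]
    exact Ideal.map_le_iff_le_comap.2 h3
  have hpow := Ideal.exists_pow_le_of_le_radical_of_fg hrad (IsNoetherian.noetherian _)
  obtain ⟨σ, hσ, hσm⟩ : ∃ σ, σ ∉ Ideal.span (Set.range fun i => φ (f i)) ∧
      ∀ x ∈ maximalIdeal L, x * σ ∈ Ideal.span (Set.range fun i => φ (f i)) := by
    classical
    have h1 := Nat.find_spec hpow
    obtain ⟨n, hn⟩ : ∃ n, Nat.find hpow = n + 1 := by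
      refine Nat.exists_eq_succ_of_ne_zero ?_
      intro h
      rw [h, pow_zero, Ideal.one_eq_top] at h1
      exact hne (top_le_iff.1 h1)
    have h2 := Nat.find_min hpow (m := n) (by omega)
    rw [hn] at h1
    obtain ⟨σ, hσ, hσI⟩ := SetLike.not_le_iff_exists.1 h2
    refine ⟨σ, hσI, fun x hx => h1 ?_⟩
    rw [pow_succ']
    exact Ideal.mul_mem_mul hx hσ
  have hVK : ∀ g, Syz (fun i => φ (f i)) g →
      (∀ i, g i ∈ Ideal.span (Set.range fun i => φ (f i))) → KM (fun i => φ (f i)) g := by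
    intro g hg hgI
    obtain ⟨b, hb, g', hg', heq⟩ := syz_num P hg
    have h1 : ∀ i, ∃ s ∈ P.primeCompl, s * g' i ∈ Ideal.span (Set.range f) := by
      intro i
      apply (IsLocalization.algebraMap_mem_map_algebraMap_iff P.primeCompl L _ _).1
      rw [heq i]
      apply Ideal.mul_mem_left
      have := hgI i
      rw [← hmap] at this
      exact this
    choose s hs hsI using h1
    have hsP : s 0 * s 1 * s 2 ∉ P :=
      (P.primeCompl.mul_mem (P.primeCompl.mul_mem (hs 0) (hs 1)) (hs 2))
    obtain ⟨j, hj⟩ := hV (fun i => (s 0 * s 1 * s 2) * g' i) (by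
      unfold Syz at *
      linear_combination (s 0 * s 1 * s 2) * hg') (by
      intro i
      have : s i ∣ s 0 * s 1 * s 2 := by
        fin_cases i
        · exact ⟨s 1 * s 2, by simp; ring⟩
        · exact ⟨s 0 * s 2, by simp; ring⟩
        · exact ⟨s 0 * s 1, by simp; ring⟩
      obtain ⟨c, hc⟩ := this
      have h3 := Ideal.mul_mem_left _ c (hsI i)
      rw [hc, mul_comm (s i) c, mul_assoc]; exact h3)
    obtain ⟨y, hy, hyP⟩ := exists_pow_not_mem hP hirr j
    have h4 := KM.map φ (hj y hy)
    have hu : IsUnit (φ y * φ (s 0 * s 1 * s 2) * φ b) :=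
      ((loc_unit P hyP).mul (loc_unit P hsP)).mul (loc_unit P hb)
    obtain ⟨u, hu⟩ := hu
    have h5 := h4.smul (↑u⁻¹ : L)
    convert h5 using 1
    funext i
    have h6 : φ (y * (s 0 * s 1 * s 2 * g' i)) = ↑u * g i := by
      rw [hu, map_mul, map_mul, heq i]; ring
    rw [h6, ← mul_assoc]; simp
  have hf0 : ∃ i, φ (f i) ≠ 0 := by
    by_contra hc
    push Not at hc
    obtain ⟨c, hc'⟩ := hDL (fun _ => 1) (by intro i j; simp only [hc])
    have := hc' 0
    simp only [hc 0, mul_zero] at this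
    exact one_ne_zero this
  obtain ⟨h, hhs, i, hi⟩ := local_key a b hab hmht (fun i => φ (f i)) hf0 hDL σ hσ hσm hVK
  obtain ⟨x, y, hxy⟩ := two_gen hhs hi
  exact ⟨x, y, hmap.trans hxy, regular_of_two_gen hDL hxy hne⟩

end KV

theorem saturated_koszul_eq_vanishing_syzygies_iff_lci
    (k : Type) [Field k]
    (f₁ f₂ f₃ : MvPolynomial (Fin 4) k) (d₁ d₁' d₂ d₂' d₃ d₃' : ℤ)
    (h₁ : Bihom f₁ d₁ d₁') (h₂ : Bihom f₂ d₂ d₂') (h₃ : Bihom f₃ d₃ d₃')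
    (I : Ideal (MvPolynomial (Fin 4) k)) (hI : I = Ideal.span {f₁, f₂, f₃})
    (hht : idealHeight I = 2)
    -- no minimal prime over I contains the irrelevant ideal:
    (hirr : ∀ P ∈ I.minimalPrimes, ¬ (irrel k ≤ P)) :
    -- K^sat = V iff I is a local complete intersection:
    (Submodule.satSet (irrel k) (Kos f₁ f₂ f₃) =
      { g : Fin 3 → MvPolynomial (Fin 4) k |
          g 0 * f₁ + g 1 * f₂ + g 2 * f₃ = 0 ∧ ∀ i, g i ∈ Ideal.sat (irrel k) I })
    ↔
    (∀ (P : Ideal (MvPolynomial (Fin 4) k)) (hP : P ∈ I.minimalPrimes),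
      letI : P.IsPrime := hP.1.1
      ∃ x y : Localization.AtPrime P,
        I.map (algebraMap (MvPolynomial (Fin 4) k) (Localization.AtPrime P)) =
          Ideal.span {x, y} ∧
        RingTheory.Sequence.IsRegular (Localization.AtPrime P) [x, y]) := by
  classical
  set f : Fin 3 → MvPolynomial (Fin 4) k := ![f₁, f₂, f₃] with hfdef
  have hIf : I = Ideal.span (Set.range f) := by rw [hI, hfdef, KV.range_vec]
  subst hIf
  have hh : ∀ P : Ideal (MvPolynomial (Fin 4) k), P.IsPrime →
      Ideal.span (Set.range f) ≤ P → 2 ≤ P.height := fun P hP hIP => KV.two_le_height hht P hIP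
  have hf : ∀ i, (f i).IsWeightedHomogeneous KV.bwl
      ((![toLex (d₁, d₁'), toLex (d₂, d₂'), toLex (d₃, d₃')] : Fin 3 → Lex (ℤ × ℤ)) i) := by
    intro i
    fin_cases i
    · exact h₁
    · exact h₂
    · exact h₃
  have hsyz : ∀ g : Fin 3 → MvPolynomial (Fin 4) k,
      g 0 * f₁ + g 1 * f₂ + g 2 * f₃ = 0 ↔ KV.Syz f g := fun g => Iff.rfl
  have hkos : ∀ g, g ∈ Kos f₁ f₂ f₃ ↔ KV.KM f g := KV.mem_Kos_iff f₁ f₂ f₃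
  constructor
  · intro hKV P hP
    have hPp : P.IsPrime := hP.1.1
    have hcore := KV.core_min f _ hf hh P hPp hP.1.2 (hirr P hP)
    have hP2 : P.height ≤ 2 := by
      have h1 := hP.2 hcore.1 (KV.core_le KV.bwl P)
      exact (Ideal.height_mono h1).trans (KV.height_core_le P hPp (hirr P hP))
    refine KV.forward f hh ?_ P hPp hP (hirr P hP) hP2
    intro g hg hgI
    have hmem : g ∈ Submodule.satSet (irrel k) (Kos f₁ f₂ f₃) := by
      rw [hKV]
      exact ⟨(hsyz g).2 hg, fun i => ⟨0, fun y _ => Ideal.mul_mem_left _ y (hgI i)⟩⟩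
    obtain ⟨j, hj⟩ := hmem
    exact ⟨j, fun y hy => (hkos _).1 (hj y hy)⟩
  · intro hlci
    ext g
    constructor
    · rintro ⟨j, hj⟩
      refine ⟨?_, fun i => ⟨j, fun y hy => ?_⟩⟩
      · obtain ⟨y, hy, hy0⟩ := KV.irrel_pow_ne (k := k) j
        have h1 := ((hkos _).1 (hj y hy)).syz
        rw [hsyz]
        unfold KV.Syz at *
        apply mul_left_cancel₀ hy0
        simp only [Pi.smul_apply, smul_eq_mul] at h1
        linear_combination h1
      · have hfI : ∀ i, f i ∈ Ideal.span (Set.range f) := fun i => Ideal.subset_span ⟨i, rfl⟩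
        exact ((hkos _).1 (hj y hy)).mem hfI i
    · rintro ⟨hg, hgs⟩
      obtain ⟨j, hj⟩ := KV.backward f _ hf hh (by
        intro P hP hmin
        obtain ⟨x, y, hxy, -⟩ := hlci P hmin
        exact ⟨x, y, hxy⟩) g ((hsyz g).1 hg) hgs
      exact ⟨j, fun y hy => (hkos _).2 (hj y hy)⟩

end
end
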